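/- arXiv:1902.04131 — 10 statements merged into one kernel-verified Lean document; each statement's English description precedes it below -/
import Mathlib

section
/- Let ν be a Borel probability measure on the interval I = [−1,1] with ∫ x dν(x) = 0 and ν({0}) < 1. Then for every ε > 0 there exists δ > 0 with the following property: whenever Q is a finite set partitioned as Q = J ⊔ K ⊔ L with |J| ≥ (1−δ)|Q| and |K| = |L|, the product measure ν^Q on I^Q assigns measure less than ε to the set {y ∈ I^Q : Σ_{q∈L} y_q ≤ −Σ_{q∈J} y_q < Σ_{q∈K} y_q}. -/
open MeasureTheory

open ProbabilityTheory Filter Topology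

/-- The law of a sum of i.i.d. coordinates depends only on the number of summands. -/
lemma map_sum_pi_eq_map_sum_infinitePi (ν : Measure ℝ) [IsProbabilityMeasure ν]
    {Q : Type*} [Fintype Q] (J : Finset Q) :
    (Measure.pi fun _ : Q => ν).map (fun y => ∑ q ∈ J, y q) =
      (Measure.infinitePi fun _ : ℕ => ν).map
        (fun y => ∑ k ∈ Finset.range J.card, y k) := by
  have hpi : iIndepFun (fun (q : Q) (y : Q → ℝ) => y q) (Measure.pi fun _ : Q => ν) :=
    iIndepFun_pi (X := fun _ x => x) fun _ => aemeasurable_id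
  have hinf : iIndepFun (fun (k : ℕ) (y : ℕ → ℝ) => y k) (Measure.infinitePi fun _ : ℕ => ν) :=
    iIndepFun_infinitePi (X := fun _ x => x) fun _ => measurable_id
  have : IsProbabilityMeasure
      ((Measure.pi fun _ : Q => ν).map (fun y => ∑ q ∈ J, y q)) :=
    Measure.isProbabilityMeasure_map (by fun_prop)
  have : IsProbabilityMeasure ((Measure.infinitePi fun _ : ℕ => ν).map
      (fun y => ∑ k ∈ Finset.range J.card, y k)) :=
    Measure.isProbabilityMeasure_map (by fun_prop)
  have hmap (q : Q) : (Measure.pi fun _ : Q => ν).map (fun y => y q) = ν :=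
    (measurePreserving_eval (fun _ : Q => ν) q).map_eq
  have hmap' (k : ℕ) : (Measure.infinitePi fun _ : ℕ => ν).map (fun y => y k) = ν :=
    (measurePreserving_eval_infinitePi (fun _ : ℕ => ν) k).map_eq
  apply Measure.ext_of_charFun
  rw [(hpi.restrict J).charFun_map_fun_finsetSum_eq_prod
      (fun i _ => (measurable_pi_apply i).aemeasurable),
    (hinf.restrict _).charFun_map_fun_finsetSum_eq_prod
      (fun i _ => (measurable_pi_apply i).aemeasurable)]
  simp [hmap, hmap']

/-- A nondegenerate Gaussian gives small mass to small intervals around `0`. -/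
lemma exists_gaussianReal_closedBall_lt {v : NNReal} (hv : v ≠ 0) {c : ENNReal} (hc : 0 < c) :
    ∃ η : ℝ, 0 < η ∧ gaussianReal 0 v (Metric.closedBall 0 η) < c := by
  have := nullSingletonClass_gaussianReal (μ := 0) hv
  have h := tendsto_measure_cthickening_of_isClosed (μ := gaussianReal 0 v) (s := {(0 : ℝ)})
    ⟨1, one_pos, measure_ne_top _ _⟩ isClosed_singleton
  rw [measure_singleton] at h
  obtain ⟨η, hη, hpos⟩ := ((h.eventually_lt_const hc).filter_mono nhdsWithin_le_nhds
    |>.and (self_mem_nhdsWithin (s := Set.Ioi (0 : ℝ)))).exists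
  refine ⟨η, hpos, ?_⟩
  rwa [Metric.cthickening_singleton 0 (le_of_lt hpos)] at hη

/-- Small-ball estimate for sums of many i.i.d. centered nondegenerate variables. -/
lemma exists_measure_abs_sum_le_lt (ν : Measure ℝ) [IsProbabilityMeasure ν]
    (hν : MemLp id 2 ν) (hmean : (∫ x, x ∂ν) = 0) (hvar : Var[id; ν] ≠ 0)
    {c : ENNReal} (hc : 0 < c) :
    ∃ η : ℝ, 0 < η ∧ ∃ M : ℕ, ∀ (Q : Type) (_ : Fintype Q) (J : Finset Q), M ≤ J.card →
      Measure.pi (fun _ : Q => ν) {y | |∑ q ∈ J, y q| ≤ η * √J.card} < c := by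
  have hv : Var[id; ν].toNNReal ≠ 0 := by
    simpa using lt_of_le_of_ne (variance_nonneg _ _) hvar.symm
  obtain ⟨η, hη, hball⟩ := exists_gaussianReal_closedBall_lt hv hc
  refine ⟨η, hη, ?_⟩
  set P := Measure.infinitePi fun _ : ℕ => ν
  have hmp (k : ℕ) : MeasurePreserving (fun y : ℕ → ℝ => y k) P ν :=
    measurePreserving_eval_infinitePi (fun _ : ℕ => ν) k
  have hvarP : Var[fun y : ℕ → ℝ => y 0; P] = Var[id; ν] := by
    rw [← variance_id_map (hmp 0).aemeasurable, (hmp 0).map_eq]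
  have hmeanP : ∫ y, y 0 ∂P = 0 := by
    rw [← hmean, ← (hmp 0).map_eq, integral_map (hmp 0).aemeasurable (by fun_prop)]
  have hindep : iIndepFun (fun (k : ℕ) (y : ℕ → ℝ) => y k) P :=
    iIndepFun_infinitePi (X := fun _ x => x) fun _ => measurable_id
  have hclt := tendstoInDistribution_inv_sqrt_mul_sum_sub
    (X := fun (k : ℕ) (y : ℕ → ℝ) => y k) (P := P)
    (Y := id) (P' := gaussianReal 0 Var[fun y : ℕ → ℝ => y 0; P].toNNReal) HasLaw.id
    (hν.comp_measurePreserving (hmp 0)) hindep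
    (fun k => ⟨(hmp k).aemeasurable, (hmp 0).aemeasurable, by rw [(hmp k).map_eq, (hmp 0).map_eq]⟩)
  have hlim := ProbabilityMeasure.limsup_measure_closed_le_of_tendsto hclt.tendsto
    (Metric.isClosed_closedBall (x := (0 : ℝ)) (ε := η))
  simp only [ProbabilityMeasure.coe_mk, Measure.map_id, hvarP, hmeanP] at hlim
  obtain ⟨M, hM⟩ := eventually_atTop.1 (eventually_lt_of_limsup_lt (hlim.trans_lt hball))
  refine ⟨M + 1, fun Q _ J hJ => ?_⟩
  have hpos : 0 < √(J.card : ℝ) := Real.sqrt_pos.2 (by exact_mod_cast (by omega : 0 < J.card))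
  have hclosed (a : ℝ) : MeasurableSet {x : ℝ | |x| ≤ a} :=
    (isClosed_le continuous_abs continuous_const).measurableSet
  have heq : Measure.pi (fun _ : Q => ν) {y | |∑ q ∈ J, y q| ≤ η * √J.card} =
      P {y | |∑ k ∈ Finset.range J.card, y k| ≤ η * √J.card} := by
    have := congrArg (fun μ => μ {x : ℝ | |x| ≤ η * √J.card})
      (map_sum_pi_eq_map_sum_infinitePi ν J)
    simpa only [Measure.map_apply (by fun_prop : Measurable fun y : Q → ℝ => ∑ q ∈ J, y q)
      (hclosed _), Measure.map_apply (by fun_prop : Measurable fun y : ℕ → ℝ =>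
        ∑ k ∈ Finset.range J.card, y k) (hclosed _), Set.preimage_ofPred_eq] using this
  rw [heq]
  convert hM J.card (by omega) using 1
  rw [Measure.map_apply (by fun_prop) Metric.isClosed_closedBall.measurableSet]
  congr 1
  ext y
  simp only [Set.mem_ofPred_eq, Set.mem_preimage, mem_closedBall_zero_iff, Real.norm_eq_abs,
    mul_zero, sub_zero, abs_mul, abs_inv, abs_of_pos hpos]
  rw [inv_mul_le_iff₀ hpos, mul_comm]

/-- Chebyshev's inequality for sums of i.i.d. centered variables. -/
lemma measure_le_abs_sum_le (ν : Measure ℝ) [IsProbabilityMeasure ν]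
    (hν : MemLp id 2 ν) (hmean : (∫ x, x ∂ν) = 0) {Q : Type*} [Fintype Q] (L : Finset Q)
    {r : ℝ} (hr : 0 < r) :
    Measure.pi (fun _ : Q => ν) {y | r ≤ |∑ q ∈ L, y q|} ≤
      ENNReal.ofReal (L.card * Var[id; ν] / r ^ 2) := by
  have hmp (q : Q) : MeasurePreserving (fun y : Q → ℝ => y q) (Measure.pi fun _ : Q => ν) ν :=
    measurePreserving_eval (fun _ : Q => ν) q
  have hmem (q : Q) : MemLp (fun y : Q → ℝ => y q) 2 (Measure.pi fun _ : Q => ν) :=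
    hν.comp_measurePreserving (hmp q)
  have hpi : iIndepFun (fun (q : Q) (y : Q → ℝ) => y q) (Measure.pi fun _ : Q => ν) :=
    iIndepFun_pi (X := fun _ x => x) fun _ => aemeasurable_id
  have hvar (q : Q) : Var[fun y : Q → ℝ => y q; Measure.pi fun _ : Q => ν] = Var[id; ν] := by
    rw [← variance_id_map (hmp q).aemeasurable, (hmp q).map_eq]
  have hint (q : Q) : ∫ y, y q ∂(Measure.pi fun _ : Q => ν) = 0 := by
    rw [← integral_map (f := fun x : ℝ => x) (hmp q).aemeasurable (by fun_prop), (hmp q).map_eq,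
      hmean]
  have hsum := IndepFun.variance_sum (s := L) (fun q _ => hmem q)
    (fun i _ j _ hij => hpi.indepFun hij)
  have h := meas_ge_le_variance_div_sq (memLp_finsetSum' L fun q _ => hmem q) hr
  simp only [hsum, hvar, Finset.sum_const, nsmul_eq_mul, Finset.sum_apply] at h
  rw [integral_finsetSum _ fun q _ => (hmem q).integrable one_le_two] at h
  simpa [hint] using h

/-- Central limit lemma: if `ν` is a Borel probability measure on `[-1,1]` centered at `0`
that does not give `{0}` full measure, then for every `ε > 0` there is `δ > 0` such that
for every finite set `Q` partitioned as `Q = J ⊔ K ⊔ L` with `|J| ≥ (1-δ)|Q|` and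
`|K| = |L|`, the product measure of the set
`{y : Σ_{q∈L} y_q ≤ -Σ_{q∈J} y_q < Σ_{q∈K} y_q}` is less than `ε`. -/
theorem stmt0 (ν : Measure ℝ) [IsProbabilityMeasure ν]
    (hsupp : ν (Set.Icc (-1 : ℝ) 1) = 1) (hmean : (∫ x, x ∂ν) = 0)
    (hzero : ν ({0} : Set ℝ) < 1) (ε : ℝ) (hε : 0 < ε) :
    ∃ δ : ℝ, 0 < δ ∧ ∀ (Q : Type) (_ : Fintype Q) (J K L : Finset Q),
      (∀ q : Q, q ∈ J ∨ q ∈ K ∨ q ∈ L) →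
      Disjoint J K → Disjoint J L → Disjoint K L →
      ((1 - δ) * (Fintype.card Q : ℝ) ≤ (J.card : ℝ)) → K.card = L.card →
      Measure.pi (fun _ : Q => ν)
        {y : Q → ℝ | (∑ q ∈ L, y q) ≤ -(∑ q ∈ J, y q) ∧ -(∑ q ∈ J, y q) < ∑ q ∈ K, y q}
        < ENNReal.ofReal ε := by
  classical
  have hbd : ∀ᵐ x ∂ν, x ∈ Set.Icc (-1 : ℝ) 1 := by
    rwa [ae_iff_prob_eq_one measurableSet_Icc.mem]
  have hν : MemLp id 2 ν := MemLp.of_bound aestronglyMeasurable_id 1 <| by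
    filter_upwards [hbd] with x hx using abs_le.2 hx
  have hvar1 : Var[id; ν] ≤ 1 := by
    simpa using variance_le_sq_of_bounded (X := id) hbd aemeasurable_id
  have hvar : Var[id; ν] ≠ 0 := fun h => by
    have h0 := ae_eq_integral_of_variance_eq_zero hν h
    simp only [id, hmean] at h0
    exact hzero.ne ((prob_compl_eq_zero_iff (measurableSet_singleton 0)).1 h0)
  obtain ⟨η, hη, M, hM⟩ := exists_measure_abs_sum_le_lt ν hν hmean hvar
    (ENNReal.ofReal_pos.2 (half_pos hε))
  refine ⟨min (1 / 2) (min (1 / (M + 1)) (ε * η ^ 2 / 8)), by positivity, ?_⟩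
  intro Q _ J K L hcov hJK hJL hKL hcard hKLcard
  set δ := min (1 / 2 : ℝ) (min (1 / (M + 1)) (ε * η ^ 2 / 8))
  have hδ1 : δ ≤ 1 / 2 := min_le_left _ _
  have hδ2 : δ ≤ 1 / (M + 1) := (min_le_right _ _).trans (min_le_left _ _)
  have hδ3 : δ ≤ ε * η ^ 2 / 8 := (min_le_right _ _).trans (min_le_right _ _)
  rcases Nat.eq_zero_or_pos K.card with hK | hK
  · obtain rfl := Finset.card_eq_zero.1 hK
    obtain rfl := Finset.card_eq_zero.1 (hKLcard ▸ hK)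
    have hempty : {y : Q → ℝ | (∑ q ∈ (∅ : Finset Q), y q) ≤ -(∑ q ∈ J, y q) ∧
        -(∑ q ∈ J, y q) < ∑ q ∈ (∅ : Finset Q), y q} = ∅ :=
      Set.eq_empty_of_forall_notMem fun y hy => hy.1.not_gt hy.2
    rw [hempty, measure_empty]
    exact ENNReal.ofReal_pos.2 hε
  have hn : J.card + K.card + L.card = Fintype.card Q := by
    rw [← Finset.card_union_of_disjoint hJK,
      ← Finset.card_union_of_disjoint (Finset.disjoint_union_left.2 ⟨hJL, hKL⟩),
      ← Finset.card_univ]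
    congr 1
    ext q
    simpa [or_assoc] using hcov q
  have hnR : (J.card : ℝ) + L.card + L.card = Fintype.card Q := by
    rw [← hn, hKLcard]; push_cast; ring
  have hLpos : (1 : ℝ) ≤ L.card := by exact_mod_cast hKLcard ▸ hK
  have hn0 : (0 : ℝ) ≤ Fintype.card Q := Nat.cast_nonneg _
  have hLδ : 2 * (L.card : ℝ) ≤ δ * Fintype.card Q := by linarith
  have hJhalf : (Fintype.card Q : ℝ) ≤ 2 * J.card := by nlinarith
  have hnM : 2 * ((M : ℝ) + 1) ≤ Fintype.card Q := by
    have h2 : 2 ≤ 1 / ((M : ℝ) + 1) * Fintype.card Q := by nlinarith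
    rwa [one_div_mul_eq_div, le_div_iff₀ (by positivity)] at h2
  have hMJ : M ≤ J.card := by
    have : (M : ℝ) ≤ J.card := by linarith
    exact_mod_cast this
  have hJpos : (0 : ℝ) < J.card := by linarith [(Nat.cast_nonneg M : (0 : ℝ) ≤ M)]
  have hLJ : (L.card : ℝ) ≤ ε / 4 * (η * √J.card) ^ 2 := by
    rw [mul_pow, Real.sq_sqrt hJpos.le]
    have h1 := mul_le_mul hδ3 hJhalf hn0 (by positivity)
    nlinarith
  have hr : 0 < η * √(J.card : ℝ) := by positivity
  have hcheb (A : Finset Q) (hA : A.card = L.card) :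
      Measure.pi (fun _ : Q => ν) {y | η * √J.card ≤ |∑ q ∈ A, y q|} ≤
        ENNReal.ofReal (ε / 4) := by
    refine (measure_le_abs_sum_le ν hν hmean A hr).trans (ENNReal.ofReal_le_ofReal ?_)
    rw [hA, div_le_iff₀ (by positivity)]
    exact (mul_le_of_le_one_right (Nat.cast_nonneg _) hvar1).trans hLJ
  calc Measure.pi (fun _ : Q => ν) {y : Q → ℝ | (∑ q ∈ L, y q) ≤ -(∑ q ∈ J, y q) ∧
          -(∑ q ∈ J, y q) < ∑ q ∈ K, y q}
      ≤ Measure.pi (fun _ : Q => ν) ({y | |∑ q ∈ J, y q| ≤ η * √J.card} ∪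
          ({y | η * √J.card ≤ |∑ q ∈ K, y q|} ∪ {y | η * √J.card ≤ |∑ q ∈ L, y q|})) := by
        refine measure_mono fun y hy => ?_
        obtain ⟨h1, h2⟩ := hy
        simp only [Set.mem_union, Set.mem_ofPred_eq]
        by_contra! h
        obtain ⟨hJ', hK', hL'⟩ := h
        refine hJ'.not_ge (abs_le.2 ⟨?_, ?_⟩)
        · linarith [(abs_lt.1 hK').2]
        · linarith [(abs_lt.1 hL').1]
    _ ≤ Measure.pi (fun _ : Q => ν) {y | |∑ q ∈ J, y q| ≤ η * √J.card} +
          (Measure.pi (fun _ : Q => ν) {y | η * √J.card ≤ |∑ q ∈ K, y q|} +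
            Measure.pi (fun _ : Q => ν) {y | η * √J.card ≤ |∑ q ∈ L, y q|}) :=
        (measure_union_le _ _).trans (by gcongr; exact measure_union_le _ _)
    _ < ENNReal.ofReal (ε / 2) + (ENNReal.ofReal (ε / 4) + ENNReal.ofReal (ε / 4)) := by
        have hKLle := add_le_add (hcheb K hKLcard) (hcheb L rfl)
        exact ENNReal.add_lt_add_of_lt_of_le (ne_top_of_le_ne_top (by simp) hKLle)
          (hM Q _ J hMJ) hKLle
    _ = ENNReal.ofReal ε := by
        rw [← ENNReal.ofReal_add (by positivity) (by positivity),
          ← ENNReal.ofReal_add (by positivity) (by positivity)]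
        congr 1
        ring
end

section
/- Let Γ be a group, let T be a finite subset of Γ containing the identity element, and let F be a (T,1/2)-invariant nonempty finite subset of Γ. Then there exists a set C ⊆ Γ with |C| ≥ |F|/(2|T|²) such that the left translates Tc for c ∈ C are pairwise disjoint and all contained in F. -/
/-- `E` is `(K, δ)`-invariant: `|E ∩ ⋂_{s ∈ K} s⁻¹E| ≥ (1 - δ)|E|`. -/
def Finset.IsInvUnder {Γ : Type*} [Group Γ] (E : Finset Γ) (K : Set Γ) (δ : ℝ) : Prop :=
  (1 - δ) * E.card ≤ (((↑E : Set Γ) ∩ ⋂ s ∈ K, (fun g => s * g) ⁻¹' (↑E : Set Γ)).ncard : ℝ)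

open scoped Pointwise in
/-- Greedy packing: a finite set `A` contains a set `C` whose translates `T * c` are pairwise
disjoint and with `|A| ≤ |T|² |C|`. -/
theorem Finset.exists_pairwiseDisjoint_translates {Γ : Type*} [Group Γ] (T A : Finset Γ)
    (hT : T.Nonempty) :
    ∃ C ⊆ A, A.card ≤ T.card ^ 2 * C.card ∧
      (C : Set Γ).PairwiseDisjoint fun c => (fun t => t * c) '' (T : Set Γ) := by
  classical
  obtain ⟨C, hC, hmax⟩ := Finset.exists_max_image
    (A.powerset.filter fun C : Finset Γ =>
      (C : Set Γ).PairwiseDisjoint fun c => (fun t => t * c) '' (T : Set Γ))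
    Finset.card ⟨∅, by simp⟩
  simp only [mem_filter, mem_powerset] at hC hmax
  refine ⟨C, hC.1, ?_, hC.2⟩
  have hcover : A ⊆ T⁻¹ * T * C := by
    intro a ha
    by_cases haC : a ∈ C
    · obtain ⟨t, ht⟩ := hT
      simpa using mul_mem_mul (mul_mem_mul (inv_mem_inv ht) ht) haC
    by_contra hnot
    have hins := hmax (insert a C) ⟨insert_subset ha hC.1, ?_⟩
    · rw [card_insert_of_notMem haC] at hins
      omega
    rw [coe_insert]
    refine hC.2.insert fun c hc _ => Set.disjoint_left.2 ?_
    rintro _ ⟨s, hs, rfl⟩ ⟨t, ht, hst⟩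
    refine hnot ?_
    have hst : t * c = s * a := hst
    have ha' : a = s⁻¹ * t * c := by rw [mul_assoc, hst, inv_mul_cancel_left]
    rw [ha']
    exact mul_mem_mul (mul_mem_mul (inv_mem_inv hs) ht) hc
  calc A.card ≤ (T⁻¹ * T * C).card := card_le_card hcover
    _ ≤ (T⁻¹ * T).card * C.card := card_mul_le
    _ ≤ T⁻¹.card * T.card * C.card := Nat.mul_le_mul_right _ card_mul_le
    _ = T.card ^ 2 * C.card := by rw [card_inv, sq]

/-- Given a finite subset `T` of a group `Γ` containing the identity and a
`(T, 1/2)`-invariant nonempty finite subset `F` of `Γ`, there is a set `C ⊆ Γ` with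
`|C| ≥ |F| / (2|T|²)` such that the translates `Tc` for `c ∈ C` are pairwise disjoint and
contained in `F`. -/
theorem stmt2 {Γ : Type*} [Group Γ] (T F : Finset Γ) (hT : (1 : Γ) ∈ T)
    (hF : F.Nonempty) (hinv : F.IsInvUnder (↑T : Set Γ) (1/2)) :
    ∃ C : Finset Γ, (F.card : ℝ) / (2 * (T.card : ℝ) ^ 2) ≤ (C.card : ℝ) ∧
      ((↑C : Set Γ).PairwiseDisjoint fun c => (fun t => t * c) '' (↑T : Set Γ)) ∧
      ∀ c ∈ C, (fun t => t * c) '' (↑T : Set Γ) ⊆ (↑F : Set Γ) := by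
  classical
  set A : Finset Γ := F.filter fun g => ∀ s ∈ T, s * g ∈ F with hA
  have hAF : (F : Set Γ) ∩ ⋂ s ∈ (T : Set Γ), (fun g => s * g) ⁻¹' (F : Set Γ) = A := by
    ext g
    simp [hA]
  rw [Finset.IsInvUnder, hAF, Set.ncard_coe_finset] at hinv
  obtain ⟨C, hCA, hcard, hdisj⟩ := T.exists_pairwiseDisjoint_translates A ⟨1, hT⟩
  refine ⟨C, ?_, hdisj, ?_⟩
  · have hTpos : (0 : ℝ) < T.card := by exact_mod_cast Finset.card_pos.2 ⟨1, hT⟩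
    have hcard' : (A.card : ℝ) ≤ (T.card : ℝ) ^ 2 * C.card := by exact_mod_cast hcard
    rw [div_le_iff₀ (by positivity)]
    linarith
  · rintro c hc _ ⟨t, ht, rfl⟩
    exact (Finset.mem_filter.1 (hCA hc)).2 t ht
end

section
/- Let G and H be groups and let G ↷ X and H ↷ Y be free continuous actions on compact metrizable spaces. Let Φ : X → Y be a homeomorphism and let κ : G × X → H and λ : H × Y → G be continuous maps (G and H carrying the discrete topology) satisfying Φ(sx) = κ(s,x)Φ(x) for all s ∈ G, x ∈ X, and Φ^{-1}(ty) = λ(t,y)Φ^{-1}(y) for all t ∈ H, y ∈ Y. Let L be a finite subset of H and δ > 0, and let E be a nonempty finite subset of G which is (λ(L,Y), δ)-invariant, where λ(L,Y) = {λ(t,y) : t ∈ L, y ∈ Y} (a finite subset of G by continuity and compactness). Then for every x ∈ X the set κ(E,x) = {κ(g,x) : g ∈ E} is an (L,δ)-invariant finite subset of H of cardinality |E|. -/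
/-- Transfer of approximate invariance under a continuous orbit equivalence: if
`Φ : X → Y` is a continuous orbit equivalence between free actions with continuous
cocycles `κ` and `lam`, `L ⊆ H` is finite, `δ > 0`, and `E ⊆ G` is a nonempty finite
`(lam(L,Y), δ)`-invariant set, then for every `x ∈ X` the set `κ(E, x) ⊆ H` has
cardinality `|E|` and is `(L, δ)`-invariant. -/
theorem stmt4 {G H X Y : Type*} [Group G] [Group H] [DecidableEq H]
    [TopologicalSpace X] [TopologicalSpace Y] [CompactSpace X] [CompactSpace Y]
    [TopologicalSpace.MetrizableSpace X] [TopologicalSpace.MetrizableSpace Y]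
    [MulAction G X] [MulAction H Y]
    (hGcont : ∀ g : G, Continuous fun x : X => g • x)
    (hHcont : ∀ h : H, Continuous fun y : Y => h • y)
    (hGfree : ∀ (g : G) (x : X), g • x = x → g = 1)
    (hHfree : ∀ (h : H) (y : Y), h • y = y → h = 1)
    (Φ : X ≃ₜ Y) (κ : G → X → H) (lam : H → Y → G)
    (hκ : ∀ g : G, IsLocallyConstant (κ g))
    (hlam : ∀ h : H, IsLocallyConstant (lam h))
    (hΦ : ∀ (g : G) (x : X), Φ (g • x) = κ g x • Φ x)
    (hΨ : ∀ (h : H) (y : Y), Φ.symm (h • y) = lam h y • Φ.symm y)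
    (L : Finset H) (δ : ℝ) (E : Finset G) (hE : E.Nonempty)
    (hinv : E.IsInvUnder {g : G | ∃ t ∈ L, ∃ y : Y, lam t y = g} δ)
    (x : X) :
    (E.image fun g => κ g x).card = E.card ∧
      (E.image fun g => κ g x).IsInvUnder (↑L : Set H) δ := by
  have smul_inj : ∀ (h h' : H) (y : Y), h • y = h' • y → h = h' := fun h h' y e => by
    have := hHfree (h'⁻¹ * h) y (by rw [mul_smul, e, inv_smul_smul])
    exact (inv_mul_eq_one.mp this).symm
  have inj : Function.Injective fun g => κ g x := fun g g' e => by
    have e' : g • x = g' • x := Φ.injective (by rw [hΦ, hΦ]; exact congrArg (· • Φ x) e)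
    have := hGfree (g'⁻¹ * g) x (by rw [mul_smul, e', inv_smul_smul])
    exact (inv_mul_eq_one.mp this).symm
  have cocycle : ∀ (t : H) (g : G), t * κ g x = κ (lam t (Φ (g • x)) * g) x := fun t g => by
    apply smul_inj _ _ (Φ x)
    rw [mul_smul, ← hΦ, ← hΦ, mul_smul, ← Φ.symm_apply_eq, hΨ, Φ.symm_apply_apply]
  have card_image : (E.image fun g => κ g x).card = E.card :=
    Finset.card_image_of_injective E inj
  refine ⟨card_image, ?_⟩
  unfold Finset.IsInvUnder at hinv ⊢
  rw [card_image]
  refine hinv.trans ?_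
  rw [← Set.ncard_image_of_injective _ inj]
  refine Nat.cast_le.mpr (Set.ncard_le_ncard ?_ (Set.Finite.inter_of_left (Finset.finite_toSet _) _))
  rintro _ ⟨g, ⟨hgE, hg⟩, rfl⟩
  refine ⟨Finset.mem_coe.mpr (Finset.mem_image_of_mem _ hgE), Set.mem_iInter₂.mpr fun t ht => ?_⟩
  have hmem := Set.mem_iInter₂.mp hg (lam t (Φ (g • x))) ⟨t, ht, _, rfl⟩
  simp only [Set.mem_preimage, cocycle]
  exact Finset.mem_coe.mpr (Finset.mem_image_of_mem (fun g => κ g x) hmem)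
end

section
/- Let G be an infinite group with a finite symmetric generating set S, and suppose that G is not virtually cyclic, i.e., G has no cyclic subgroup of finite index. Then there exists a constant b > 0 such that for every integer r ≥ 1 and every connected finite subset F ⊆ G satisfying |S^r F| ≤ 2|F| there exists a finite tree whose vertex set V is contained in F, has cardinality at most b|F|/r, and is 2r-spanning for F, and each of whose edges {v,w} satisfies d_S(v,w) ≤ 4r+1. -/
open scoped Pointwise

/-- The set of products of at most `r` elements of `S`. -/
def sBall {G : Type*} [Group G] (S : Finset G) (r : ℕ) : Set G :=
  ((↑S : Set G) ∪ {1}) ^ r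

/-- The word distance (w.r.t. `S`) from `v` to `w` is at most `r`. -/
def wordDistLE {G : Type*} [Group G] (S : Finset G) (v w : G) (r : ℕ) : Prop :=
  v⁻¹ * w ∈ sBall S r

/-- `F` is connected for the word metric associated to `S`: any two of its elements are
joined by a path inside `F` whose steps have word length at most `1`. -/
def SConnected {G : Type*} [Group G] (S : Finset G) (F : Finset G) : Prop :=
  F.Nonempty ∧ ∀ v ∈ F, ∀ w ∈ F, ∃ (n : ℕ) (p : ℕ → G), p 0 = v ∧ p n = w ∧
    (∀ i ≤ n, p i ∈ F) ∧ ∀ i < n, wordDistLE S (p i) (p (i + 1)) 1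

section WordDistance

variable {G : Type*} [Group G] {S : Finset G}

lemma sBall_mul (S : Finset G) (m n : ℕ) : sBall S m * sBall S n = sBall S (m + n) :=
  (pow_add _ _ _).symm

lemma sBall_finite (S : Finset G) (r : ℕ) : (sBall S r).Finite := by
  induction r with
  | zero => simp [sBall]
  | succ r ih =>
    rw [← sBall_mul]
    exact ih.mul (by simp [sBall])

lemma one_mem_sBall (S : Finset G) (r : ℕ) : (1 : G) ∈ sBall S r :=
  Set.one_mem_pow (by simp)

lemma sBall_mono (S : Finset G) {m n : ℕ} (h : m ≤ n) : sBall S m ⊆ sBall S n :=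
  Set.pow_subset_pow_right (by simp) h

lemma sBall_inv (hsym : ∀ s ∈ S, s⁻¹ ∈ S) (r : ℕ) : (sBall S r)⁻¹ = sBall S r := by
  have h : ((↑S : Set G) ∪ {1})⁻¹ = ↑S ∪ {1} := by
    ext x
    have : x⁻¹ ∈ S ↔ x ∈ S := ⟨fun hx => by simpa using hsym _ hx, hsym x⟩
    simp [this]
  rw [sBall, ← inv_pow, h]

lemma wordDistLE_refl (v : G) (r : ℕ) : wordDistLE S v v r := by
  simpa [wordDistLE] using one_mem_sBall S r

lemma wordDistLE.symm (hsym : ∀ s ∈ S, s⁻¹ ∈ S) {v w : G} {r : ℕ} (h : wordDistLE S v w r) :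
    wordDistLE S w v r := by
  rw [wordDistLE, ← sBall_inv hsym]
  simpa [wordDistLE] using h

lemma wordDistLE.trans {u v w : G} {m n : ℕ} (h₁ : wordDistLE S u v m)
    (h₂ : wordDistLE S v w n) : wordDistLE S u w (m + n) := by
  rw [wordDistLE, ← sBall_mul]
  simpa [mul_assoc] using Set.mul_mem_mul h₁ h₂

lemma wordDistLE.mono {v w : G} {m n : ℕ} (h : wordDistLE S v w m) (hmn : m ≤ n) :
    wordDistLE S v w n :=
  sBall_mono S hmn h

/-- In an infinite group, balls grow at least linearly. -/
lemma add_one_le_ncard_sBall [Infinite G] (hgen : Subgroup.closure (↑S : Set G) = ⊤) (r : ℕ) :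
    r + 1 ≤ (sBall S r).ncard := by
  classical
  have hcl : Subgroup.closure (↑(S ∪ {1}) : Set G) = ⊤ :=
    top_le_iff.mp (hgen ▸ Subgroup.closure_mono (by simp))
  have h := Finset.add_one_le_card_pow (X := S ∪ {1}) (by simp)
    (by rw [hcl]; exact Set.infinite_univ) r
  rw [← Set.ncard_coe_finset] at h
  simpa [sBall] using h

open scoped Classical in
/-- If a connected set is not contained in a ball about one of its points, then it meets
that ball in a number of points exceeding the radius. -/
lemma SConnected.add_one_le_card_ball {F : Finset G} (hF : SConnected S F) {v w : G}
    (hv : v ∈ F) (hw : w ∈ F) {r k : ℕ} (hvw : ¬ wordDistLE S v w r) (hk : k ≤ r) :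
    k + 1 ≤ (F.filter fun x => wordDistLE S v x k).card := by
  induction k with
  | zero => exact Finset.card_pos.mpr ⟨v, by simp [hv, wordDistLE_refl]⟩
  | succ k ih =>
    obtain ⟨n, p, rfl, rfl, hpF, hp⟩ := hF.2 v hv w hw
    obtain ⟨i, hin, hi, hi'⟩ : ∃ i < n, wordDistLE S (p 0) (p i) k ∧
        ¬ wordDistLE S (p 0) (p (i + 1)) k := by
      by_contra! h
      have key : ∀ i ≤ n, wordDistLE S (p 0) (p i) k := by
        intro i
        induction i with
        | zero => exact fun _ => wordDistLE_refl _ _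
        | succ i ihi => exact fun hi => h i hi (ihi (by lia))
      exact hvw ((key n le_rfl).mono (by lia))
    refine Nat.succ_le_of_lt ((ih (by lia)).trans_lt (Finset.card_lt_card ?_))
    refine (Finset.ssubset_iff_of_subset ?_).mpr ⟨p (i + 1), ?_, ?_⟩
    · exact Finset.monotone_filter_right _ fun x _ hx => hx.mono (by lia)
    · exact Finset.mem_filter.mpr ⟨hpF _ hin, hi.trans (hp i hin)⟩
    · simp [hi']

end WordDistance

/-- A finite set contains a maximal subset of pairwise unrelated points. -/
lemma Finset.exists_separated_spanning {α : Type*} (R : α → α → Prop) (hrefl : ∀ a, R a a)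
    (hsymm : ∀ a b, R a b → R b a) (F : Finset α) :
    ∃ V ⊆ F, (∀ v ∈ V, ∀ w ∈ V, v ≠ w → ¬ R v w) ∧ ∀ a ∈ F, ∃ w ∈ V, R a w := by
  classical
  induction F using Finset.induction with
  | empty => exact ⟨∅, by simp⟩
  | insert a F _ ih =>
    obtain ⟨V, hVF, hsep, hspan⟩ := ih
    by_cases h : ∃ w ∈ V, R a w
    · refine ⟨V, hVF.trans (Finset.subset_insert a F), hsep, fun b hb => ?_⟩
      rcases Finset.mem_insert.mp hb with rfl | hb
      exacts [h, hspan b hb]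
    · push Not at h
      refine ⟨insert a V, Finset.insert_subset_insert a hVF, ?_, fun b hb => ?_⟩
      · intro v hv w hw hvw
        rcases Finset.mem_insert.mp hv with rfl | hvV <;>
          rcases Finset.mem_insert.mp hw with rfl | hwV
        · exact absurd rfl hvw
        · exact h w hwV
        · exact fun hR => h v hvV (hsymm _ _ hR)
        · exact hsep v hvV w hwV hvw
      · rcases Finset.mem_insert.mp hb with rfl | hb
        · exact ⟨b, Finset.mem_insert_self _ _, hrefl b⟩
        · obtain ⟨w, hw, hbw⟩ := hspan b hb
          exact ⟨w, Finset.mem_insert_of_mem hw, hbw⟩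

section SpanningTree

variable {G : Type*} [Group G] {S : Finset G}

/-- An `r`-spanning subset of a connected set carries a tree whose edges have length at most
`2 * r + 1`. -/
lemma SConnected.exists_isTree (hsym : ∀ s ∈ S, s⁻¹ ∈ S) {F V : Finset G}
    (hF : SConnected S F) (hVF : V ⊆ F) {r : ℕ}
    (hspan : ∀ v ∈ F, ∃ w ∈ V, wordDistLE S v w r) :
    ∃ T : SimpleGraph {u // u ∈ V}, T.IsTree ∧
      ∀ u w : {u // u ∈ V}, T.Adj u w → wordDistLE S u.1 w.1 (2 * r + 1) := by
  let Γ : SimpleGraph {u // u ∈ V} :=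
    { Adj := fun u w => u ≠ w ∧ wordDistLE S u.1 w.1 (2 * r + 1)
      symm := ⟨fun _ _ h => ⟨h.1.symm, h.2.symm hsym⟩⟩
      loopless := ⟨fun _ h => h.1 rfl⟩ }
  have hadj : ∀ u w : {u // u ∈ V}, wordDistLE S u.1 w.1 (2 * r + 1) → Γ.Reachable u w := by
    intro u w h
    by_cases huw : u = w
    · exact huw ▸ SimpleGraph.Reachable.refl u
    · exact SimpleGraph.Adj.reachable ⟨huw, h⟩
  have hΓ : Γ.Connected := by
    refine SimpleGraph.connected_iff_exists_forall_reachable Γ |>.mpr ?_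
    obtain ⟨x, hx⟩ := hF.1
    obtain ⟨u, hu, -⟩ := hspan x hx
    refine ⟨⟨u, hu⟩, fun w => ?_⟩
    obtain ⟨n, p, hp0, hpn, hpF, hp⟩ := hF.2 u (hVF hu) w.1 (hVF w.2)
    have key : ∀ i ≤ n, ∀ c : {u // u ∈ V}, wordDistLE S (p i) c.1 r →
        Γ.Reachable ⟨u, hu⟩ c := by
      intro i
      induction i with
      | zero =>
        intro _ c hc
        exact hadj _ _ ((hp0 ▸ hc).mono (by lia))
      | succ i ih =>
        intro hi c hc
        obtain ⟨d, hd, hid⟩ := hspan (p i) (hpF i (by lia))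
        refine (ih (by lia) ⟨d, hd⟩ hid).trans (hadj _ _ ?_)
        exact (((hid.symm hsym).trans (hp i hi)).trans hc).mono (by lia)
    exact key n le_rfl w (hpn ▸ wordDistLE_refl _ _)
  obtain ⟨T, hT, hTree⟩ := hΓ.exists_isTree_le
  exact ⟨T, hTree, fun u w h => (hT h).2⟩

/-- A set of at least two points of a connected set `F` at pairwise distance more than `2 * r`
has at most `|F| / r` elements. -/
lemma SConnected.card_mul_le (hsym : ∀ s ∈ S, s⁻¹ ∈ S) {F V : Finset G} (hF : SConnected S F)
    (hVF : V ⊆ F) {r : ℕ} (hV : V.Nontrivial)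
    (hsep : ∀ v ∈ V, ∀ w ∈ V, v ≠ w → ¬ wordDistLE S v w (2 * r)) :
    V.card * r ≤ F.card := by
  classical
  have hdisj : (V : Set G).PairwiseDisjoint fun v => F.filter fun x => wordDistLE S v x r := by
    intro v hv w hw hvw
    refine Finset.disjoint_left.mpr fun x hx hx' => hsep v hv w hw hvw ?_
    rw [Finset.mem_filter] at hx hx'
    exact (hx.2.trans (hx'.2.symm hsym)).mono (by lia)
  calc V.card * r ≤ ∑ v ∈ V, (F.filter fun x => wordDistLE S v x r).card := by
        rw [← smul_eq_mul]
        refine Finset.card_nsmul_le_sum _ _ _ fun v hv => ?_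
        obtain ⟨w, hw, hwv⟩ := hV.exists_ne v
        exact (Nat.le_succ r).trans <| hF.add_one_le_card_ball (hVF hv) (hVF hw)
          (hsep v hv w hw hwv.symm) (by lia)
    _ = (V.biUnion fun v => F.filter fun x => wordDistLE S v x r).card :=
        (Finset.card_biUnion hdisj).symm
    _ ≤ F.card := Finset.card_le_card <|
        Finset.biUnion_subset.mpr fun v _ => Finset.filter_subset _ _

end SpanningTree

/-- If `G` is an infinite, non-virtually-cyclic group with finite symmetric generating set
`S`, then there is `b > 0` such that for every `r ≥ 1` and every connected finite
`F ⊆ G` with `|SʳF| ≤ 2|F|` there is a `2r`-spanning tree in `F` with at most `b|F|/r`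
vertices whose edges join points at word distance at most `4r + 1`. -/
theorem stmt5 {G : Type*} [Group G] [Infinite G] (S : Finset G)
    (hsym : ∀ s ∈ S, s⁻¹ ∈ S) (hgen : Subgroup.closure (↑S : Set G) = ⊤)
    (hnvc : ¬ ∃ H : Subgroup G, H.FiniteIndex ∧ IsCyclic H) :
    ∃ b : ℝ, 0 < b ∧ ∀ r : ℕ, 1 ≤ r → ∀ F : Finset G, SConnected S F →
      ((sBall S r * (↑F : Set G)).ncard : ℝ) ≤ 2 * (F.card : ℝ) →
      ∃ V : Finset G, (↑V : Set G) ⊆ (↑F : Set G) ∧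
        (V.card : ℝ) ≤ b * (F.card : ℝ) / (r : ℝ) ∧
        (∀ v ∈ F, ∃ w ∈ V, wordDistLE S v w (2 * r)) ∧
        ∃ T : SimpleGraph {u // u ∈ V}, T.IsTree ∧
          ∀ u w : {u // u ∈ V}, T.Adj u w → wordDistLE S u.1 w.1 (4 * r + 1) := by
  refine ⟨2, two_pos, fun r hr F hF hcard => ?_⟩
  obtain ⟨V, hVF, hsep, hspan⟩ := F.exists_separated_spanning
    (fun v w => wordDistLE S v w (2 * r)) (fun v => wordDistLE_refl v _)
    (fun v w h => h.symm hsym)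
  refine ⟨V, by exact_mod_cast hVF, ?_, hspan, ?_⟩
  · have hr' : (0 : ℝ) < r := by exact_mod_cast hr
    rw [le_div_iff₀ hr']
    rcases Nat.lt_or_ge 1 V.card with hV | hV
    · have h := hF.card_mul_le hsym hVF (Finset.one_lt_card_iff_nontrivial.mp hV) hsep
      have h' : (V.card : ℝ) * r ≤ F.card := by exact_mod_cast h
      linarith [Nat.cast_nonneg (α := ℝ) F.card]
    · obtain ⟨x, hx⟩ := hF.1
      have hle : (sBall S r).ncard ≤ (sBall S r * (↑F : Set G)).ncard := by
        rw [← Set.ncard_image_of_injective _ (mul_left_injective x)]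
        exact Set.ncard_le_ncard (Set.image_subset_iff.mpr fun y hy => Set.mul_mem_mul hy hx)
          ((sBall_finite S r).mul F.finite_toSet)
      have hrF : (r : ℝ) ≤ (sBall S r * (↑F : Set G)).ncard := by
        exact_mod_cast (Nat.le_succ r).trans ((add_one_le_ncard_sBall hgen r).trans hle)
      have hV' : (V.card : ℝ) ≤ 1 := by exact_mod_cast hV
      nlinarith
  · obtain ⟨T, hT, hTadj⟩ := hF.exists_isTree hsym hVF hspan
    exact ⟨T, hT, fun u w h => (hTadj u w h).mono (by lia)⟩
end

section
/- Let Γ ↷ X be an action of a countable group by homeomorphisms on the Cantor set. If there exists m ∈ ℕ such that every Γ-orbit in X has cardinality at most m, then the topological full group [[Γ ↷ X]] is locally finite, i.e., every finitely generated subgroup of [[Γ ↷ X]] is finite. -/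
/-- A permutation `T` of `X` is a piecewise translation for the action of `Γ` if there are a
finite clopen partition `A₁, …, Aₙ` of `X` and `s₁, …, sₙ ∈ Γ` with `T x = sᵢ • x` on `Aᵢ`.
The topological full group `[[Γ ↷ X]]` is the set of such permutations. -/
def IsPiecewiseTranslation (Γ : Type*) {X : Type*} [Group Γ] [TopologicalSpace X]
    [MulAction Γ X] (T : Equiv.Perm X) : Prop :=
  ∃ (n : ℕ) (A : Fin n → Set X) (s : Fin n → Γ),
    (∀ i, IsClopen (A i)) ∧ Pairwise (Function.onFun Disjoint A) ∧
    (⋃ i, A i) = Set.univ ∧ ∀ i, ∀ x ∈ A i, T x = s i • x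

theorem MonoidHom.finite_of_group_fg (G K : Type*) [Group G] [Group.FG G] [Group K] [Finite K] :
    Finite (G →* K) := by
  obtain ⟨S, hS⟩ := Group.FG.out (G := G)
  refine Finite.of_injective (fun (φ : G →* K) (s : S) => φ s) fun φ ψ h => ?_
  exact MonoidHom.eq_of_eqOn_dense hS fun s hs => congrFun h ⟨s, hs⟩

/-- A finitely generated group acting faithfully with orbits of uniformly bounded cardinality is
finite. -/
theorem finite_of_faithfulSMul_of_orbit_ncard_le {G X : Type*} [Group G] [Group.FG G]
    [MulAction G X] [FaithfulSMul G X] (m : ℕ)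
    (hm : ∀ x : X, (MulAction.orbit G x).Finite ∧ (MulAction.orbit G x).ncard ≤ m) :
    Finite G := by
  have := MonoidHom.finite_of_group_fg G (Equiv.Perm (Fin m))
  refine Finite.of_injective
    (fun (g : G) (φ : G →* Equiv.Perm (Fin m)) => φ g) fun g h hgh => ?_
  refine FaithfulSMul.eq_of_smul_eq_smul (α := X) fun x => ?_
  have := (hm x).1.to_subtype
  let ι : MulAction.orbit G x ↪ Fin m :=
    (Finite.equivFin _).toEmbedding.trans (Fin.castLEEmb (hm x).2)
  have key := Equiv.Perm.viaEmbeddingHom_injective ι <| congrFun hgh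
    ((Equiv.Perm.viaEmbeddingHom ι).comp (MulAction.toPermHom G (MulAction.orbit G x)))
  exact congrArg Subtype.val (Equiv.congr_fun key ⟨x, MulAction.mem_orbit_self x⟩)

/-- If the orbits of an action of a countable group `Γ` on the Cantor set `X` have uniformly
bounded cardinality, then the topological full group is locally finite: every finitely
generated subgroup of `Perm X` consisting of piecewise translations is finite. -/
theorem stmt6 {Γ X : Type*} [Group Γ] [Countable Γ] [TopologicalSpace X] [CompactSpace X]
    [TopologicalSpace.MetrizableSpace X] [TotallyDisconnectedSpace X] [Nonempty X] [MulAction Γ X]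
    (hiso : ∀ x : X, ¬ IsOpen ({x} : Set X))
    (hcont : ∀ g : Γ, Continuous fun x : X => g • x)
    (hbound : ∃ m : ℕ, ∀ x : X,
      (MulAction.orbit Γ x).Finite ∧ (MulAction.orbit Γ x).ncard ≤ m) :
    ∀ H : Subgroup (Equiv.Perm X),
      (H : Set (Equiv.Perm X)) ⊆ {T | IsPiecewiseTranslation Γ T} → H.FG → Finite H := by
  intro H hH hfg
  obtain ⟨m, hm⟩ := hbound
  have : Group.FG H := (Group.fg_iff_subgroup_fg H).2 hfg
  refine finite_of_faithfulSMul_of_orbit_ncard_le (G := H) (X := X) m fun x => ?_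
  have hsub : MulAction.orbit H x ⊆ MulAction.orbit Γ x := by
    rintro _ ⟨T, rfl⟩
    obtain ⟨n, A, s, -, -, hcover, hT⟩ := hH T.2
    obtain ⟨i, hi⟩ := Set.mem_iUnion.1 (hcover.symm ▸ Set.mem_univ x)
    exact ⟨s i, (hT i x hi).symm⟩
  exact ⟨(hm x).1.subset hsub, (Set.ncard_le_ncard hsub (hm x).1).trans (hm x).2⟩
end

section
/- Let Γ ↷ X be an action of a countable group by homeomorphisms on the Cantor set, and let X₀ denote the set of points x ∈ X with the property that for every open neighborhood U of x and every n ∈ ℕ there exists y ∈ X such that |Γy ∩ U| ≥ n. Then X₀ is closed and Γ-invariant, and X₀ = ∅ if and only if there exists m ∈ ℕ such that every Γ-orbit in X has cardinality at most m. -/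
open scoped Pointwise

/-- The set of points `x ∈ X` such that every open neighborhood of `x` meets some `Γ`-orbit
in at least `n` points, for every `n`. -/
def manyOrbitPoints (Γ X : Type*) [Group Γ] [TopologicalSpace X] [MulAction Γ X] :
    Set X :=
  {x | ∀ U : Set X, IsOpen U → x ∈ U → ∀ n : ℕ,
    ∃ (y : X) (W : Finset X), (↑W : Set X) ⊆ MulAction.orbit Γ y ∩ U ∧ n ≤ W.card}

theorem isClosed_manyOrbitPoints (Γ X : Type*) [Group Γ] [TopologicalSpace X]
    [MulAction Γ X] : IsClosed (manyOrbitPoints Γ X) := by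
  refine isClosed_of_closure_subset fun x hx U hU hxU n => ?_
  obtain ⟨z, hzU, hz⟩ := mem_closure_iff.1 hx U hU hxU
  exact hz U hU hzU n

theorem smul_mem_manyOrbitPoints {Γ X : Type*} [Group Γ] [TopologicalSpace X] [MulAction Γ X]
    {g : Γ} (hg : Continuous fun x : X => g • x) {x : X} (hx : x ∈ manyOrbitPoints Γ X) :
    g • x ∈ manyOrbitPoints Γ X := by
  intro U hU hxU n
  obtain ⟨y, W, hW, hn⟩ := hx _ (hU.preimage hg) hxU n
  refine ⟨y, W.map ⟨fun z => g • z, MulAction.injective g⟩, fun z hz => ?_, by simpa using hn⟩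
  obtain ⟨w, hw, rfl⟩ := Finset.mem_map.1 hz
  exact ⟨MulAction.mem_orbit_of_mem_orbit g (hW hw).1, (hW hw).2⟩

theorem smul_manyOrbitPoints {Γ X : Type*} [Group Γ] [TopologicalSpace X] [MulAction Γ X]
    (hcont : ∀ g : Γ, Continuous fun x : X => g • x) (g : Γ) :
    g • manyOrbitPoints Γ X = manyOrbitPoints Γ X := by
  ext x
  rw [Set.mem_smul_set_iff_inv_smul_mem]
  refine ⟨fun h => ?_, smul_mem_manyOrbitPoints (hcont g⁻¹)⟩
  simpa using smul_mem_manyOrbitPoints (hcont g) h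

theorem exists_card_le_of_manyOrbitPoints_eq_empty {Γ X : Type*} [Group Γ] [TopologicalSpace X]
    [CompactSpace X] [MulAction Γ X] (h : manyOrbitPoints Γ X = ∅) :
    ∃ m : ℕ, ∀ (y : X) (W : Finset X), (↑W : Set X) ⊆ MulAction.orbit Γ y → W.card ≤ m := by
  classical
  suffices H : ∃ m : ℕ, ∀ (y : X) (W : Finset X),
      (↑W : Set X) ⊆ MulAction.orbit Γ y ∩ Set.univ → W.card ≤ m by
    simpa only [Set.inter_univ] using H
  refine isCompact_univ.induction_on (p := fun s => ∃ m : ℕ, ∀ (y : X) (W : Finset X),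
    (↑W : Set X) ⊆ MulAction.orbit Γ y ∩ s → W.card ≤ m) ?_ ?_ ?_ ?_
  · refine ⟨0, fun y W hW => ?_⟩
    rw [Set.inter_empty, Set.subset_empty_iff, Finset.coe_eq_empty] at hW
    simp [hW]
  · rintro s t hst ⟨m, hm⟩
    exact ⟨m, fun y W hW => hm y W (hW.trans (Set.inter_subset_inter_right _ hst))⟩
  · rintro s t ⟨m, hm⟩ ⟨k, hk⟩
    refine ⟨m + k, fun y W hW => ?_⟩
    rw [← Finset.card_filter_add_card_filter_not (s := W) (· ∈ s)]
    refine add_le_add (hm y _ fun z hz => ?_) (hk y _ fun z hz => ?_)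
    · obtain ⟨hzW, hzs⟩ := Finset.mem_filter.1 hz
      exact ⟨(hW hzW).1, hzs⟩
    · obtain ⟨hzW, hzs⟩ := Finset.mem_filter.1 hz
      exact ⟨(hW hzW).1, (hW hzW).2.resolve_left hzs⟩
  · intro x _
    have hx : x ∉ manyOrbitPoints Γ X := h ▸ Set.notMem_empty x
    simp only [manyOrbitPoints, Set.mem_ofPred_eq] at hx
    push Not at hx
    obtain ⟨U, hU, hxU, n, hn⟩ := hx
    exact ⟨U, mem_nhdsWithin_of_mem_nhds (hU.mem_nhds hxU), n, fun y W hW => (hn y W hW).le⟩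

theorem manyOrbitPoints_eq_empty_iff {Γ X : Type*} [Group Γ] [TopologicalSpace X]
    [CompactSpace X] [MulAction Γ X] :
    manyOrbitPoints Γ X = ∅ ↔
      ∃ m : ℕ, ∀ x : X, (MulAction.orbit Γ x).Finite ∧ (MulAction.orbit Γ x).ncard ≤ m := by
  constructor
  · intro h
    obtain ⟨m, hm⟩ := exists_card_le_of_manyOrbitPoints_eq_empty h
    refine ⟨m, fun x => ?_⟩
    have hfin : (MulAction.orbit Γ x).Finite := by
      by_contra hinf
      obtain ⟨W, hW, hcard⟩ := Set.Infinite.exists_subset_card_eq hinf (m + 1)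
      have := hm x W hW
      omega
    refine ⟨hfin, ?_⟩
    rw [Set.ncard_eq_toFinset_card _ hfin]
    exact hm x _ hfin.coe_toFinset.subset
  · rintro ⟨m, hm⟩
    refine Set.eq_empty_of_forall_notMem fun x hx => ?_
    obtain ⟨y, W, hW, hn⟩ := hx Set.univ isOpen_univ (Set.mem_univ x) (m + 1)
    have hle := Set.ncard_le_ncard (hW.trans Set.inter_subset_left) (hm y).1
    rw [Set.ncard_coe_finset] at hle
    have := (hm y).2
    omega

/-- For an action of a countable group `Γ` on the Cantor set `X`, the set `X₀` of points all
of whose neighborhoods meet orbits in arbitrarily many points is closed and `Γ`-invariant,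
and `X₀ = ∅` iff the `Γ`-orbits have uniformly bounded cardinality. -/
theorem stmt7 {Γ X : Type*} [Group Γ] [Countable Γ] [TopologicalSpace X] [CompactSpace X]
    [TopologicalSpace.MetrizableSpace X] [TotallyDisconnectedSpace X] [Nonempty X]
    [MulAction Γ X]
    (hiso : ∀ x : X, ¬ IsOpen ({x} : Set X))
    (hcont : ∀ g : Γ, Continuous fun x : X => g • x) :
    IsClosed (manyOrbitPoints Γ X) ∧
    (∀ g : Γ, g • manyOrbitPoints Γ X = manyOrbitPoints Γ X) ∧
    (manyOrbitPoints Γ X = ∅ ↔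
      ∃ m : ℕ, ∀ x : X, (MulAction.orbit Γ x).Finite ∧ (MulAction.orbit Γ x).ncard ≤ m) :=
  ⟨isClosed_manyOrbitPoints Γ X, smul_manyOrbitPoints hcont, manyOrbitPoints_eq_empty_iff⟩
end

section
/- Let Γ ↷ X be an action of a countable group by homeomorphisms on the Cantor set, let X₀ denote the set of points x ∈ X with the property that for every open neighborhood U of x and every n ∈ ℕ there exists y ∈ X such that |Γy ∩ U| ≥ n, and suppose X₀ ≠ ∅. Let x ∈ X₀, let F be a finite subset of X containing x, and let G be a subgroup of [[Γ ↷ X]] containing 𝔄(Γ,X). Then there exist sequences (c_n)_{n∈ℕ} and (d_n)_{n∈ℕ} in G_(F) ∩ 𝔄(Γ,X) which are both asymptotically central in G_(x) and satisfy c_n d_n ≠ d_n c_n for every n. -/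
/-- The dynamical alternating group `𝔄(Γ, X)`. -/
def dynAlternating (Γ X : Type*) [Group Γ] [TopologicalSpace X] [MulAction Γ X] :
    Subgroup (Equiv.Perm X) :=
  Subgroup.closure
    {g | ∃ (φ : Equiv.Perm (Fin 3) →* Equiv.Perm X) (A : Fin 3 → Set X),
      (∀ σ, IsPiecewiseTranslation Γ (φ σ)) ∧ (∀ i, IsClopen (A i)) ∧
      Pairwise (Function.onFun Disjoint A) ∧
      (∀ (σ : Equiv.Perm (Fin 3)), ∀ x ∉ ⋃ i, A i, φ σ x = x) ∧
      (∀ (σ : Equiv.Perm (Fin 3)) (i : Fin 3), φ σ '' A i = A (σ i)) ∧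
      ∃ σ : Equiv.Perm (Fin 3), Equiv.Perm.sign σ = 1 ∧ g = φ σ}

/-- `g` fixes pointwise a neighborhood of every point of `F`. -/
def fixesNbhdOf {X : Type*} [TopologicalSpace X] (g : Equiv.Perm X) (F : Set X) : Prop :=
  ∀ x ∈ F, ∃ U : Set X, IsOpen U ∧ x ∈ U ∧ ∀ y ∈ U, g y = y

/-- The permutation action of `Perm (Fin 3)` on three disjoint translates of `A`. -/
noncomputable def translateHom {Γ X : Type*} [Group Γ] [MulAction Γ X] (g : Fin 3 → Γ)
    (A : Set X) (hinj : Function.Injective fun q : Fin 3 × A => g q.1 • (q.2 : X)) :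
    Equiv.Perm (Fin 3) →* Equiv.Perm X :=
  (Equiv.Perm.viaEmbeddingHom ⟨_, hinj⟩).comp
    { toFun := fun σ => Equiv.prodCongr σ (Equiv.refl A)
      map_one' := rfl
      map_mul' := fun _ _ => rfl }

theorem translateHom_apply {Γ X : Type*} [Group Γ] [MulAction Γ X] (g : Fin 3 → Γ)
    (A : Set X) (hinj : Function.Injective fun q : Fin 3 × A => g q.1 • (q.2 : X))
    (σ : Equiv.Perm (Fin 3)) (i : Fin 3) {a : X} (ha : a ∈ A) :
    translateHom g A hinj σ (g i • a) = g (σ i) • a :=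
  Equiv.Perm.viaEmbedding_apply (Equiv.prodCongr σ (Equiv.refl A))
    ⟨fun q : Fin 3 × A => g q.1 • (q.2 : X), hinj⟩ (i, ⟨a, ha⟩)

theorem translateHom_apply_of_notMem {Γ X : Type*} [Group Γ] [MulAction Γ X] (g : Fin 3 → Γ)
    (A : Set X) (hinj : Function.Injective fun q : Fin 3 × A => g q.1 • (q.2 : X))
    (σ : Equiv.Perm (Fin 3)) {z : X} (hz : z ∉ ⋃ i, (fun a => g i • a) '' A) :
    translateHom g A hinj σ z = z := by
  refine Equiv.Perm.viaEmbedding_apply_of_notMem _ _ z ?_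
  rintro ⟨⟨i, a⟩, rfl⟩
  exact hz (Set.mem_iUnion.2 ⟨i, a, a.2, rfl⟩)

theorem isClopen_smul_image {Γ X : Type*} [Group Γ] [TopologicalSpace X] [MulAction Γ X]
    (hcont : ∀ g : Γ, Continuous fun x : X => g • x) (g : Γ) {A : Set X} (hA : IsClopen A) :
    IsClopen ((fun a => g • a) '' A) := by
  have : (fun a : X => g • a) '' A = (fun a => g⁻¹ • a) ⁻¹' A := by
    ext z
    constructor
    · rintro ⟨a, ha, rfl⟩
      simpa using ha
    · intro hz
      exact ⟨g⁻¹ • z, hz, by simp⟩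
  rw [this]
  exact hA.preimage (hcont g⁻¹)

/-- Three disjoint clopen translates of `A` are cyclically permuted by an element of the
alternating group supported on their union. -/
theorem exists_dynAlternating_rotation {Γ X : Type*} [Group Γ] [TopologicalSpace X]
    [MulAction Γ X] (hcont : ∀ g : Γ, Continuous fun x : X => g • x) (g : Fin 3 → Γ)
    {A : Set X} (hA : IsClopen A)
    (hdisj : Pairwise (Function.onFun Disjoint fun i => (fun a => g i • a) '' A)) :
    ∃ c ∈ dynAlternating Γ X, (∀ z ∉ ⋃ i, (fun a => g i • a) '' A, c z = z) ∧
      ∀ i, ∀ a ∈ A, c (g i • a) = g (finRotate 3 i) • a := by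
  have hinj : Function.Injective fun q : Fin 3 × A => g q.1 • (q.2 : X) := by
    rintro ⟨i, a⟩ ⟨j, b⟩ h
    dsimp only at h
    have hij : i = j := by
      by_contra hne
      exact Set.disjoint_left.1 (hdisj hne) ⟨a, a.2, rfl⟩ ⟨b, b.2, h.symm⟩
    subst hij
    exact Prod.ext rfl (Subtype.ext (smul_left_cancel _ h))
  have hclopen i : IsClopen ((fun a => g i • a) '' A) := isClopen_smul_image hcont (g i) hA
  refine ⟨translateHom g A hinj (finRotate 3), Subgroup.subset_closure
    ⟨translateHom g A hinj, fun i => (fun a => g i • a) '' A, fun σ => ?_, hclopen, hdisj,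
      fun σ z hz => translateHom_apply_of_notMem g A hinj σ hz, fun σ i => ?_,
      finRotate 3, by decide, rfl⟩,
    fun z hz => translateHom_apply_of_notMem g A hinj _ hz,
    fun i a ha => translateHom_apply g A hinj _ i ha⟩
  · refine ⟨4, Fin.cons (⋃ i, (fun a => g i • a) '' A)ᶜ fun i => (fun a => g i • a) '' A,
      Fin.cons 1 fun i => g (σ i) * (g i)⁻¹, ?_, ?_, ?_, ?_⟩
    · refine Fin.cases ?_ fun i => ?_
      · exact (isClopen_iUnion_of_finite hclopen).compl
      · exact hclopen i
    · have hcompl (i : Fin 3) : Disjoint (⋃ i, (fun a => g i • a) '' A)ᶜ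
          ((fun a => g i • a) '' A) :=
        Set.disjoint_left.2 fun z hz hi => hz (Set.mem_iUnion.2 ⟨i, hi⟩)
      refine Fin.cases (Fin.cases ?_ fun j _ => ?_) fun i => Fin.cases (fun _ => ?_) fun j hij => ?_
      · exact fun h => absurd rfl h
      · exact hcompl j
      · exact (hcompl i).symm
      · exact hdisj fun h => hij (congrArg Fin.succ h)
    · refine Set.eq_univ_of_forall fun z => ?_
      by_cases hz : z ∈ ⋃ i, (fun a => g i • a) '' A
      · obtain ⟨i, hi⟩ := Set.mem_iUnion.1 hz
        exact Set.mem_iUnion.2 ⟨i.succ, hi⟩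
      · exact Set.mem_iUnion.2 ⟨0, hz⟩
    · refine Fin.cases (fun z hz => ?_) fun i z hz => ?_
      · simpa using translateHom_apply_of_notMem g A hinj σ hz
      · obtain ⟨a, ha, rfl⟩ := hz
        simpa [mul_smul] using translateHom_apply g A hinj σ i ha
  · rw [Set.image_image]
    exact Set.image_congr fun a ha => translateHom_apply g A hinj σ i ha

/-- Every open neighborhood of a point of `manyOrbitPoints` supports two noncommuting elements of
the alternating group which are trivial near a given finite set. -/
theorem exists_noncommuting_supported_in {Γ X : Type*} [Group Γ] [TopologicalSpace X]
    [CompactSpace X] [T2Space X] [TotallyDisconnectedSpace X] [MulAction Γ X]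
    (hcont : ∀ g : Γ, Continuous fun x : X => g • x)
    {x : X} (hx : x ∈ manyOrbitPoints Γ X) (F : Finset X) {U : Set X} (hU : IsOpen U)
    (hxU : x ∈ U) :
    ∃ c d : Equiv.Perm X,
      (c ∈ dynAlternating Γ X ∧ fixesNbhdOf c (↑F : Set X) ∧ ∀ z ∉ U, c z = z) ∧
      (d ∈ dynAlternating Γ X ∧ fixesNbhdOf d (↑F : Set X) ∧ ∀ z ∉ U, d z = z) ∧
      c * d ≠ d * c := by
  classical
  obtain ⟨y, W, hW, hcard⟩ := hx U hU hxU (F.card + 4)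
  have hcard' : 4 ≤ (W \ F).card := by
    have := Finset.le_card_sdiff F W
    omega
  obtain ⟨T, hT, hT4⟩ := Finset.exists_subset_card_eq hcard'
  let e : Fin 4 ≃ T := (T.equivFinOfCardEq hT4).symm
  have hTW (i : Fin 4) : (e i : X) ∈ W ∧ (e i : X) ∉ F := Finset.mem_sdiff.1 (hT (e i).2)
  have hsmul (i : Fin 4) : ∃ k : Γ, k • y = e i := (hW (hTW i).1).1
  choose k hk using hsmul
  obtain ⟨N, hN, hNdisj⟩ := T.finite_toSet.t2_separation
  let B : Set X := ⋂ i, (fun a => k i • a) ⁻¹' (N (e i) ∩ (U ∩ (↑F : Set X)ᶜ))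
  have hBopen : IsOpen B := isOpen_iInter_of_finite fun i =>
    ((hN _).2.inter (hU.inter F.finite_toSet.isClosed.isOpen_compl)).preimage (hcont (k i))
  have hyB : y ∈ B := by
    refine Set.mem_iInter.2 fun i => ?_
    rw [Set.mem_preimage, hk]
    exact ⟨(hN _).1, (hW (hTW i).1).2, (hTW i).2⟩
  obtain ⟨A, hA, hyA, hAB⟩ := compact_exists_isClopen_in_isOpen hBopen hyB
  have hsub (i : Fin 4) : (fun a => k i • a) '' A ⊆ N (e i) ∩ (U ∩ (↑F : Set X)ᶜ) := by
    rintro _ ⟨a, ha, rfl⟩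
    exact Set.mem_iInter.1 (hAB ha) i
  have hdisj : Pairwise (Function.onFun Disjoint fun i => (fun a => k i • a) '' A) :=
    fun i j hij => (hNdisj (e i).2 (e j).2 fun h => hij (e.injective (Subtype.ext h))).mono
      ((hsub i).trans Set.inter_subset_left) ((hsub j).trans Set.inter_subset_left)
  have key (f : Fin 3 → Fin 4) (hf : Function.Injective f) :
      ∃ c : Equiv.Perm X,
        (c ∈ dynAlternating Γ X ∧ fixesNbhdOf c (↑F : Set X) ∧ ∀ z ∉ U, c z = z) ∧
        (∀ i, c (e (f i)) = e (f (finRotate 3 i))) ∧ ∀ j, j ∉ Set.range f → c (e j) = e j := by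
    obtain ⟨c, hc, hfix, hrot⟩ := exists_dynAlternating_rotation hcont (fun i => k (f i)) hA
      fun i j hij => hdisj (hf.ne hij)
    refine ⟨c, ⟨hc, fun z hz => ⟨(⋃ i, (fun a => k (f i) • a) '' A)ᶜ, ?_, ?_, hfix⟩,
      fun z hz => hfix z fun h => ?_⟩, fun i => ?_, fun j hj => hfix _ fun h => ?_⟩
    · exact (isClopen_iUnion_of_finite fun i =>
        isClopen_smul_image hcont (k (f i)) hA).compl.isOpen
    · intro h
      obtain ⟨i, hi⟩ := Set.mem_iUnion.1 h
      exact (hsub _ hi).2.2 hz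
    · obtain ⟨i, hi⟩ := Set.mem_iUnion.1 h
      exact hz (hsub _ hi).2.1
    · simpa only [hk] using hrot i y hyA
    · obtain ⟨i, hi⟩ := Set.mem_iUnion.1 h
      exact Set.disjoint_left.1 (hdisj fun h : f i = j => hj ⟨i, h⟩) hi ⟨y, hyA, hk j⟩
  obtain ⟨c, hc, hcrot, hcfix⟩ := key Fin.castSucc (Fin.castSucc_injective 3)
  obtain ⟨d, hd, hdrot, hdfix⟩ := key Fin.succ (Fin.succ_injective 3)
  refine ⟨c, d, hc, hd, fun h => ?_⟩
  have h0 := Equiv.congr_fun h (e 0)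
  have hd0 : d (e 0) = e 0 := hdfix 0 (by simp)
  have hc0 : c (e 0) = e 1 := hcrot 0
  have hd1 : d (e 1) = e 2 := hdrot 0
  rw [Equiv.Perm.mul_apply, Equiv.Perm.mul_apply, hd0, hc0, hd1] at h0
  exact absurd (e.injective (Subtype.ext h0)) (by decide)

/-- A permutation that is trivial on `U` commutes with one supported in `U`. -/
theorem mul_comm_of_fixes_of_supported {X : Type*} {h c : Equiv.Perm X} {U : Set X}
    (hh : ∀ z ∈ U, h z = z) (hc : ∀ z ∉ U, c z = z) : h * c = c * h := by
  refine Equiv.Perm.Disjoint.commute fun z => ?_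
  by_cases hz : z ∈ U
  · exact Or.inl (hh z hz)
  · exact Or.inr (hc z hz)

/-- If `x ∈ X₀`, `F` is a finite subset of `X` containing `x`, and `G` is a subgroup of the
topological full group containing `𝔄(Γ, X)`, then `G_(x)` contains two noncommuting
asymptotically central sequences lying in `G_(F) ∩ 𝔄(Γ, X)`. -/
theorem stmt8 {Γ X : Type*} [Group Γ] [Countable Γ] [TopologicalSpace X] [CompactSpace X]
    [TopologicalSpace.MetrizableSpace X] [TotallyDisconnectedSpace X] [Nonempty X]
    [MulAction Γ X]
    (hiso : ∀ x : X, ¬ IsOpen ({x} : Set X))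
    (hcont : ∀ g : Γ, Continuous fun x : X => g • x)
    (x : X) (hx : x ∈ manyOrbitPoints Γ X) (F : Finset X) (hxF : x ∈ F)
    (G : Subgroup (Equiv.Perm X))
    (hG : (G : Set (Equiv.Perm X)) ⊆ {T | IsPiecewiseTranslation Γ T})
    (halt : dynAlternating Γ X ≤ G) :
    ∃ c d : ℕ → Equiv.Perm X,
      (∀ n, c n ∈ G ∧ fixesNbhdOf (c n) (↑F : Set X) ∧ c n ∈ dynAlternating Γ X) ∧
      (∀ n, d n ∈ G ∧ fixesNbhdOf (d n) (↑F : Set X) ∧ d n ∈ dynAlternating Γ X) ∧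
      (∀ h : Equiv.Perm X, h ∈ G → fixesNbhdOf h ({x} : Set X) →
        {n : ℕ | ¬ h * c n = c n * h}.Finite) ∧
      (∀ h : Equiv.Perm X, h ∈ G → fixesNbhdOf h ({x} : Set X) →
        {n : ℕ | ¬ h * d n = d n * h}.Finite) ∧
      ∀ n, c n * d n ≠ d n * c n := by
  obtain ⟨V, hV⟩ := (nhds_basis_opens x).exists_antitone_subbasis
  choose c d hc hd hcd using fun n =>
    exists_noncommuting_supported_in hcont hx F (hV.1 n).2 (hV.1 n).1
  have hcentral (b : ℕ → Equiv.Perm X) (hb : ∀ n, ∀ z ∉ V n, b n z = z) (h : Equiv.Perm X)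
      (hfix : fixesNbhdOf h ({x} : Set X)) : {n : ℕ | ¬ h * b n = b n * h}.Finite := by
    obtain ⟨U, hU, hxU, hUfix⟩ := hfix x rfl
    obtain ⟨N, -, hN⟩ := hV.2.1.mem_iff.1 (hU.mem_nhds hxU)
    refine (Set.finite_lt_nat N).subset fun n hn => ?_
    by_contra hlt
    exact hn (mul_comm_of_fixes_of_supported
      (fun z hz => hUfix z (hN (hV.2.antitone (not_lt.1 hlt) hz))) (hb n))
  exact ⟨c, d, fun n => ⟨halt (hc n).1, (hc n).2.1, (hc n).1⟩,
    fun n => ⟨halt (hd n).1, (hd n).2.1, (hd n).1⟩,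
    fun h _ => hcentral c (fun n => (hc n).2.2) h,
    fun h _ => hcentral d (fun n => (hd n).2.2) h, hcd⟩
end

section
/- Let Γ ↷ X be an action of a countable group on the Cantor set and assume that the set of points of X whose orbit contains at least four points is dense in X. Then every subgroup G of [[Γ ↷ X]] containing 𝔄(Γ,X) is ICC, i.e., every element of G other than the identity has an infinite conjugacy class in G. -/
open Equiv in
/-- `S₃` permuting the copies `f i • U` of a set `U`, and fixing every other point. -/
noncomputable def permuteTranslates {ι Γ X : Type*} [Group Γ] [MulAction Γ X]
    (f : ι → Γ) (U : Set X)
    (hf : Function.Injective fun p : ι × U => f p.1 • (p.2 : X)) : Perm ι →* Perm X :=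
  (Perm.viaEmbeddingHom ⟨_, hf⟩).comp
    { toFun := fun σ => σ.prodCongr (Equiv.refl U)
      map_one' := rfl
      map_mul' := fun _ _ => rfl }

section permuteTranslates

variable {ι Γ X : Type*} [Group Γ] [MulAction Γ X] {f : ι → Γ} {U : Set X}
  (hf : Function.Injective fun p : ι × U => f p.1 • (p.2 : X))

theorem permuteTranslates_smul (σ : Equiv.Perm ι) (i : ι) {u : X} (hu : u ∈ U) :
    permuteTranslates f U hf σ (f i • u) = f (σ i) • u :=
  Equiv.Perm.viaEmbedding_apply (σ.prodCongr (Equiv.refl U)) ⟨_, hf⟩ (i, ⟨u, hu⟩)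

theorem permuteTranslates_of_notMem (σ : Equiv.Perm ι) {y : X}
    (hy : ∀ i, ∀ u ∈ U, f i • u ≠ y) : permuteTranslates f U hf σ y = y := by
  refine Equiv.Perm.viaEmbedding_apply_of_notMem (σ.prodCongr (Equiv.refl U)) ⟨_, hf⟩ y ?_
  rintro ⟨⟨i, u, hu⟩, h⟩
  exact hy i u hu h

end permuteTranslates

theorem permuteTranslates_mem_dynAlternating {Γ X : Type*} [Group Γ] [TopologicalSpace X]
    [MulAction Γ X] (hcont : ∀ g : Γ, Continuous fun x : X => g • x)
    {f : Fin 3 → Γ} {U : Set X} (hU : IsClopen U)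
    (hf : Function.Injective fun p : Fin 3 × U => f p.1 • (p.2 : X))
    {σ : Equiv.Perm (Fin 3)} (hσ : Equiv.Perm.sign σ = 1) :
    permuteTranslates f U hf σ ∈ dynAlternating Γ X := by
  have hclopen : ∀ i, IsClopen ((fun u : X => f i • u) '' U) := fun i => by
    have : (fun u : X => f i • u) '' U = (fun y : X => (f i)⁻¹ • y) ⁻¹' U := by
      ext y
      constructor
      · rintro ⟨u, hu, rfl⟩
        simpa using hu
      · exact fun hy => ⟨_, hy, by simp⟩
    rw [this]
    exact hU.preimage (hcont _)
  have hdisj : Pairwise (Function.onFun Disjoint fun i => (fun u : X => f i • u) '' U) := by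
    intro i j hij
    refine Set.disjoint_left.2 ?_
    rintro _ ⟨u, hu, rfl⟩ ⟨v, hv, h⟩
    exact hij (congrArg Prod.fst (@hf (j, ⟨v, hv⟩) (i, ⟨u, hu⟩) h)).symm
  have hfix : ∀ (τ : Equiv.Perm (Fin 3)), ∀ x ∉ ⋃ i, (fun u : X => f i • u) '' U,
      permuteTranslates f U hf τ x = x := fun τ x hx =>
    permuteTranslates_of_notMem hf τ fun i u hu h => hx (Set.mem_iUnion.2 ⟨i, u, hu, h⟩)
  refine Subgroup.subset_closure ⟨permuteTranslates f U hf,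
    fun i => (fun u : X => f i • u) '' U, fun τ => ?_, hclopen, hdisj, hfix, fun τ i => ?_,
    σ, hσ, rfl⟩
  · refine ⟨4, Fin.cons (⋃ i, (fun u : X => f i • u) '' U)ᶜ fun i => (fun u : X => f i • u) '' U,
      Fin.cons 1 fun i => f (τ i) * (f i)⁻¹, fun i => ?_, fun i j hij => ?_, ?_, fun i => ?_⟩
    · refine Fin.cases ?_ (fun i => ?_) i
      · exact (isClopen_iUnion_of_finite hclopen).compl
      · exact hclopen i
    · have key : ∀ i, Disjoint (⋃ i, (fun u : X => f i • u) '' U)ᶜ ((fun u : X => f i • u) '' U) :=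
        fun i => disjoint_compl_left.mono_right
          (Set.subset_iUnion (fun i => (fun u : X => f i • u) '' U) i)
      cases i using Fin.cases with
      | zero =>
        cases j using Fin.cases with
        | zero => exact (hij rfl).elim
        | succ j => exact key j
      | succ i =>
        cases j using Fin.cases with
        | zero => exact (key i).symm
        | succ j => exact hdisj fun h => hij (congrArg Fin.succ h)
    · refine Set.eq_univ_of_forall fun x => ?_
      by_cases hx : x ∈ ⋃ i, (fun u : X => f i • u) '' U
      · obtain ⟨i, hi⟩ := Set.mem_iUnion.1 hx
        exact Set.mem_iUnion.2 ⟨i.succ, hi⟩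
      · exact Set.mem_iUnion.2 ⟨0, hx⟩
    · cases i using Fin.cases with
      | zero =>
        intro x hx
        simpa using hfix τ x hx
      | succ i =>
        rintro _ ⟨u, hu, rfl⟩
        simpa [mul_smul] using permuteTranslates_smul hf τ i hu
  · rw [Set.image_image]
    exact Set.image_congr fun u hu => permuteTranslates_smul hf τ i hu

/-- Finitely many continuous maps with distinct values at `x` have disjoint images of some
clopen neighbourhood of `x`. -/
theorem exists_isClopen_forall_ne {ι X Y : Type*} [Finite ι] [TopologicalSpace X] [CompactSpace X]
    [T2Space X] [TotallyDisconnectedSpace X] [TopologicalSpace Y] [T2Space Y] {F : ι → X → Y}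
    (hF : ∀ i, Continuous (F i)) {x : X} (hx : Function.Injective fun i => F i x)
    {A : Set X} (hA : IsOpen A) (hxA : x ∈ A) :
    ∃ U : Set X, IsClopen U ∧ x ∈ U ∧ U ⊆ A ∧
      ∀ i j, i ≠ j → ∀ u ∈ U, ∀ v ∈ U, F i u ≠ F j v := by
  obtain ⟨V, hV, hVd⟩ := (Set.finite_range fun i => F i x).t2_separation
  obtain ⟨U, hU, hxU, hUsub⟩ := compact_exists_isClopen_in_isOpen
    (hA.inter (isOpen_iInter_of_finite fun i => (hV (F i x)).2.preimage (hF i)))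
    ⟨hxA, Set.mem_iInter.2 fun i => (hV (F i x)).1⟩
  refine ⟨U, hU, hxU, fun u hu => (hUsub hu).1, fun i j hij u hu v hv h => ?_⟩
  refine Set.disjoint_left.1 (hVd ⟨i, rfl⟩ ⟨j, rfl⟩ (hx.ne hij))
    (Set.mem_iInter.1 (hUsub hu).2 i) ?_
  rw [h]
  exact Set.mem_iInter.1 (hUsub hv).2 j

/-- Conjugating `g` by the `3`-cycle `U → b • U → c • U → U` produces a map that sends `b • u`
to `g u` exactly for those `u ∈ V` which lie in `U`. -/
theorem permuteTranslates_conj_apply_eq_iff {Γ X : Type*} [Group Γ] [MulAction Γ X]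
    {f : Fin 4 → Γ} {U V : Set X} (hUV : U ⊆ V)
    (hV : ∀ i j, i ≠ j → ∀ u ∈ V, ∀ v ∈ V, f i • u ≠ f j • v)
    (hf : Function.Injective fun p : Fin 3 × U => f p.1.castSucc • (p.2 : X))
    {g : Equiv.Perm X} (hg : ∀ u ∈ V, g (f 0 • u) = f 3 • u) {u : X} (hu : u ∈ V) :
    (permuteTranslates (fun i : Fin 3 => f i.castSucc) U hf (finRotate 3) * g *
      (permuteTranslates (fun i : Fin 3 => f i.castSucc) U hf (finRotate 3))⁻¹) (f 1 • u) =
        f 3 • u ↔ u ∈ U := by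
  set h := permuteTranslates (fun i : Fin 3 => f i.castSucc) U hf (finRotate 3)
  have h3 : h (f 3 • u) = f 3 • u := permuteTranslates_of_notMem hf _ fun i v hv =>
    hV i.castSucc 3 (Fin.castSucc_lt_last i).ne v (hUV hv) u hu
  simp only [Equiv.Perm.mul_apply]
  by_cases huU : u ∈ U
  · have h0 : h (f 0 • u) = f 1 • u := permuteTranslates_smul hf (finRotate 3) 0 huU
    rw [← h0, Equiv.Perm.inv_eq_iff_eq.2 rfl, hg u hu, h3]
    exact iff_of_true rfl huU
  · have h1 : h (f 1 • u) = f 1 • u := by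
      refine permuteTranslates_of_notMem hf _ fun i v hv hvu => ?_
      by_cases hi : i.castSucc = 1
      · rw [hi, smul_left_cancel_iff] at hvu
        exact huU (hvu ▸ hv)
      · exact hV _ _ hi v (hUV hv) u hu hvu
    rw [Equiv.Perm.inv_eq_iff_eq.2 h1.symm]
    refine iff_of_false (fun h => ?_) huU
    rw [← hg u hu] at h3 h
    have := g.injective (Equiv.injective _ (h.trans h3.symm))
    exact hV 1 0 (by decide) u hu u hu this

/-- If the set of points with orbit of cardinality at least `4` is dense, then every
subgroup of the topological full group containing `𝔄(Γ, X)` is ICC. -/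
theorem stmt9 {Γ X : Type*} [Group Γ] [Countable Γ] [TopologicalSpace X] [CompactSpace X]
    [TopologicalSpace.MetrizableSpace X] [TotallyDisconnectedSpace X] [Nonempty X]
    [MulAction Γ X]
    (hiso : ∀ x : X, ¬ IsOpen ({x} : Set X))
    (hcont : ∀ g : Γ, Continuous fun x : X => g • x)
    (hdense : Dense {x : X | ∃ W : Finset X,
      (↑W : Set X) ⊆ MulAction.orbit Γ x ∧ 4 ≤ W.card})
    (G : Subgroup (Equiv.Perm X))
    (hG : (G : Set (Equiv.Perm X)) ⊆ {T | IsPiecewiseTranslation Γ T})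
    (halt : dynAlternating Γ X ≤ G) :
    ∀ g ∈ G, g ≠ 1 → {k : Equiv.Perm X | ∃ h ∈ G, h * g * h⁻¹ = k}.Infinite := by
  intro g hg hg1 hfin
  obtain ⟨x₀, hx₀⟩ : ∃ x, g x ≠ x := by
    by_contra! h
    exact hg1 (Equiv.ext h)
  obtain ⟨n, A, s, hA, -, hAuniv, hAs⟩ := hG hg
  obtain ⟨i₀, hi₀⟩ := Set.mem_iUnion.1 (hAuniv ▸ Set.mem_univ x₀ : x₀ ∈ ⋃ i, A i)
  obtain ⟨x, ⟨hxA, hsx⟩, W, hW, hW4⟩ := hdense.inter_open_nonempty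
    (A i₀ ∩ {y | s i₀ • y ≠ y})
    ((hA i₀).isOpen.inter (isOpen_ne_fun (hcont _) continuous_id))
    ⟨x₀, hi₀, fun h => hx₀ ((hAs i₀ x₀ hi₀).trans h)⟩
  classical
  have hcard : 1 < (W \ {x, s i₀ • x}).card := by
    have h1 := Finset.le_card_sdiff {x, s i₀ • x} W
    have h2 : ({x, s i₀ • x} : Finset X).card ≤ 2 := Finset.card_le_two
    omega
  obtain ⟨y, hy, z, hz, hyz⟩ := Finset.one_lt_card.1 hcard
  simp only [Finset.mem_sdiff, Finset.mem_insert, Finset.mem_singleton, not_or] at hy hz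
  obtain ⟨b, rfl⟩ := hW hy.1
  obtain ⟨c, rfl⟩ := hW hz.1
  let f : Fin 4 → Γ := ![1, b, c, s i₀]
  have hfx : Function.Injective fun i => f i • x := by
    intro i j hij
    fin_cases i <;> fin_cases j <;> simp_all [f, eq_comm]
  obtain ⟨V, hVc, hxV, hVA, hV⟩ :=
    exists_isClopen_forall_ne (F := fun i (y : X) => f i • y) (fun i => hcont (f i)) hfx
      (hA i₀).isOpen hxA
  have hgV : ∀ u ∈ V, g (f 0 • u) = f 3 • u := fun u hu => by
    simpa [f] using hAs i₀ u (hVA hu)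
  have hVfin : V.Finite := by
    refine Set.Finite.of_finite_image (f := fun u => {k : Equiv.Perm X |
      (∃ h ∈ G, h * g * h⁻¹ = k) ∧ k (f 1 • u) = f 3 • u})
      (hfin.finite_subsets.subset ?_) ?_
    · rintro _ ⟨u, -, rfl⟩
      exact fun k hk => hk.1
    · intro u hu v hv huv
      by_contra hne
      obtain ⟨U, hU, huU, hUsub⟩ := compact_exists_isClopen_in_isOpen
        (hVc.isOpen.inter (isOpen_compl_singleton (x := v))) ⟨hu, hne⟩
      have hUV : U ⊆ V := fun w hw => (hUsub hw).1
      have hf : Function.Injective fun p : Fin 3 × U => f p.1.castSucc • (p.2 : X) := by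
        rintro ⟨i, w, hw⟩ ⟨j, w', hw'⟩ h
        obtain rfl : i = j := by
          by_contra hij
          exact hV _ _ (fun h => hij (Fin.castSucc_injective _ h)) w (hUV hw) w' (hUV hw') h
        obtain rfl : w = w' := smul_left_cancel _ h
        rfl
      have hmem := halt (permuteTranslates_mem_dynAlternating hcont
        (f := fun i : Fin 3 => f i.castSucc) hU hf
        (σ := finRotate 3) (by decide))
      have hku := (permuteTranslates_conj_apply_eq_iff hUV hV hf hgV hu).2 huU
      have hkv := (Set.ext_iff.1 huv _).1 ⟨⟨_, hmem, rfl⟩, hku⟩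
      exact (hUsub ((permuteTranslates_conj_apply_eq_iff hUV hV hf hgV hv).1 hkv.2)).2 rfl
  refine hiso x ?_
  have : ({x} : Set X) = V \ (V \ {x}) := by
    rw [Set.sdiff_sdiff_cancel_left (Set.singleton_subset_iff.2 hxV)]
  rw [this]
  exact hVc.isOpen.sdiff (hVfin.subset Set.sdiff_subset).isClosed
end

section
/- Let G be a group acting on sets X and Y. Suppose that the action G ↷ X admits a G-invariant mean, and that for every x ∈ X the action of the stabilizer subgroup G_x = {g ∈ G : gx = x} on Y admits a G_x-invariant mean. Then the action G ↷ Y admits a G-invariant mean. -/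
open scoped Pointwise

/-- A mean on a set `Z`: a finitely additive probability measure defined on all subsets. -/
def IsMean {Z : Type*} (m : Set Z → ℝ) : Prop :=
  m Set.univ = 1 ∧ (∀ A : Set Z, 0 ≤ m A) ∧
    ∀ A B : Set Z, Disjoint A B → m (A ∪ B) = m A + m B

open Filter MeasureTheory Topology

namespace IsMean

variable {Z : Type*} {m : Set Z → ℝ}

lemma empty (hm : IsMean m) : m ∅ = 0 := by
  simpa using hm.2.2 ∅ ∅ (Set.disjoint_empty ∅)

section SimpleIntegral

variable [MeasurableSpace Z]

/-- The integral of a simple function against a finitely additive set function. -/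
noncomputable def simpleIntegral (m : Set Z → ℝ) (φ : SimpleFunc Z ℝ) : ℝ :=
  φ.setToSimpleFunc fun s => m s • ContinuousLinearMap.id ℝ ℝ

lemma finMeasAdditive (hm : IsMean m) :
    FinMeasAdditive (0 : Measure Z) fun s => m s • ContinuousLinearMap.id ℝ ℝ := by
  intro s t _ _ _ _ hst
  simp only [hm.2.2 s t hst, add_smul]

lemma simpleIntegral_add (hm : IsMean m) (φ ψ : SimpleFunc Z ℝ) :
    simpleIntegral m (φ + ψ) = simpleIntegral m φ + simpleIntegral m ψ :=
  SimpleFunc.setToSimpleFunc_add _ hm.finMeasAdditive integrable_zero_measure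
    integrable_zero_measure

lemma simpleIntegral_mono (hm : IsMean m) {φ ψ : SimpleFunc Z ℝ} (h : φ ≤ ψ) :
    simpleIntegral m φ ≤ simpleIntegral m ψ := by
  refine SimpleFunc.setToSimpleFunc_mono hm.finMeasAdditive (fun s _ _ x hx => ?_)
    integrable_zero_measure integrable_zero_measure h
  simpa using mul_nonneg (hm.2.1 s) hx

lemma simpleIntegral_const (hm : IsMean m) (c : ℝ) :
    simpleIntegral m (SimpleFunc.const Z c) = c := by
  rw [simpleIntegral, SimpleFunc.setToSimpleFunc_const _ (by simp [hm.empty])]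
  simp [hm.1]

lemma simpleIntegral_eq_of_comp (e : Equiv.Perm Z) (he : ∀ A, m (e ⁻¹' A) = m A)
    {φ ψ : SimpleFunc Z ℝ} (h : ⇑ψ = φ ∘ e) :
    simpleIntegral m ψ = simpleIntegral m φ := by
  have hr : ψ.range = φ.range := by
    rw [← Finset.coe_inj, SimpleFunc.coe_range, SimpleFunc.coe_range, h,
      e.surjective.range_comp]
  simp only [simpleIntegral, SimpleFunc.setToSimpleFunc, hr, h, Set.preimage_comp, he]

variable [DiscreteMeasurableSpace Z]

/-- Approximation from below of a function with values in `[0, 1]`, within `1 / (n + 1)`. -/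
noncomputable def floorApprox (n : ℕ) (f : Z → ℝ) : SimpleFunc Z ℝ where
  toFun x := (min (n + 1) ⌊(n + 1) * f x⌋₊ : ℕ) / (n + 1 : ℝ)
  measurableSet_fiber' _ := MeasurableSet.of_discrete
  finite_range' := by
    refine ((Finset.range (n + 2)).finite_toSet.image fun k : ℕ => (k : ℝ) / (n + 1)).subset ?_
    rintro _ ⟨x, rfl⟩
    exact ⟨_, by simp, rfl⟩

lemma floorApprox_apply (n : ℕ) (f : Z → ℝ) (x : Z) :
    floorApprox n f x = (min (n + 1) ⌊(n + 1) * f x⌋₊ : ℕ) / (n + 1 : ℝ) := rfl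

lemma floorApprox_mem_Icc (n : ℕ) (f : Z → ℝ) (x : Z) :
    floorApprox n f x ∈ Set.Icc (0 : ℝ) 1 := by
  rw [floorApprox_apply]
  refine ⟨by positivity, div_le_one_of_le₀ ?_ (by positivity)⟩
  exact_mod_cast min_le_left _ _

lemma floorApprox_le (n : ℕ) {f : Z → ℝ} {x : Z} (hf : f x ∈ Set.Icc (0 : ℝ) 1) :
    floorApprox n f x ≤ f x := by
  have hn : (0 : ℝ) < n + 1 := by positivity
  rw [floorApprox_apply, div_le_iff₀ hn, mul_comm]
  exact (Nat.cast_le.2 (min_le_right _ _)).trans (Nat.floor_le (mul_nonneg hf.1 hn.le))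

lemma le_floorApprox_add (n : ℕ) {f : Z → ℝ} {x : Z} (hf : f x ∈ Set.Icc (0 : ℝ) 1) :
    f x ≤ floorApprox n f x + 1 / (n + 1) := by
  have hn : (0 : ℝ) < n + 1 := by positivity
  have hle : ⌊(n + 1) * f x⌋₊ ≤ n + 1 := by
    refine Nat.floor_le_of_le ?_
    push_cast
    exact mul_le_of_le_one_right hn.le hf.2
  rw [floorApprox_apply, min_eq_right hle, ← add_div, le_div_iff₀ hn, mul_comm]
  exact (Nat.lt_floor_add_one _).le

lemma simpleIntegral_floorApprox_mem_Icc (hm : IsMean m) (n : ℕ) (f : Z → ℝ) :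
    simpleIntegral m (floorApprox n f) ∈ Set.Icc (0 : ℝ) 1 := by
  constructor
  · rw [← hm.simpleIntegral_const 0]
    exact hm.simpleIntegral_mono fun x => (floorApprox_mem_Icc n f x).1
  · rw [← hm.simpleIntegral_const 1]
    exact hm.simpleIntegral_mono fun x => (floorApprox_mem_Icc n f x).2

end SimpleIntegral

/-- A mean extends to an additive functional on functions with values in `[0, 1]`, which is
invariant under every permutation preserving the mean. -/
theorem exists_integral (hm : IsMean m) :
    ∃ I : (Z → ℝ) → ℝ, I 1 = 1 ∧ (∀ f, 0 ≤ I f) ∧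
      (∀ f g : Z → ℝ, (∀ x, 0 ≤ f x) → (∀ x, 0 ≤ g x) → (∀ x, f x + g x ≤ 1) →
        I (f + g) = I f + I g) ∧
      ∀ e : Equiv.Perm Z, (∀ A, m (e ⁻¹' A) = m A) → ∀ f, I (f ∘ e) = I f := by
  let _ : MeasurableSpace Z := ⊤
  have _ : DiscreteMeasurableSpace Z := ⟨fun _ => trivial⟩
  let S (f : Z → ℝ) (n : ℕ) : ℝ := simpleIntegral m (floorApprox n f)
  let U := hyperfilter ℕ
  have hlim (f : Z → ℝ) : ∃ a ∈ Set.Icc (0 : ℝ) 1, Tendsto (S f) U (𝓝 a) := by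
    refine isCompact_Icc.ultrafilter_le_nhds (U.map (S f)) ?_
    exact tendsto_principal.2 <| Eventually.of_forall fun n =>
      hm.simpleIntegral_floorApprox_mem_Icc n f
  choose I hI hIlim using hlim
  have hsmall : Tendsto (fun n : ℕ => 1 / ((n : ℝ) + 1)) U (𝓝 0) :=
    tendsto_one_div_add_atTop_nhds_zero_nat.mono_left Nat.hyperfilter_le_atTop
  refine ⟨I, ?_, fun f => (hI f).1, fun f g hf hg hfg => ?_, fun e he f => ?_⟩
  · refine tendsto_nhds_unique (hIlim 1) ?_
    suffices h : S 1 = fun _ => 1 by rw [h]; exact tendsto_const_nhds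
    funext n
    have : floorApprox n (1 : Z → ℝ) = SimpleFunc.const Z 1 := by
      ext x
      have hfl : ⌊(n : ℝ) + 1⌋₊ = n + 1 := by exact_mod_cast Nat.floor_natCast (R := ℝ) (n + 1)
      have hn : (n : ℝ) + 1 ≠ 0 := by positivity
      simp [floorApprox_apply, hfl, hn]
    simp only [S, this, hm.simpleIntegral_const]
  · have hf' x : f x ∈ Set.Icc (0 : ℝ) 1 := ⟨hf x, by linarith [hg x, hfg x]⟩
    have hg' x : g x ∈ Set.Icc (0 : ℝ) 1 := ⟨hg x, by linarith [hf x, hfg x]⟩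
    have hs' x : (f + g) x ∈ Set.Icc (0 : ℝ) 1 := ⟨add_nonneg (hf x) (hg x), hfg x⟩
    have upper n : S (f + g) n ≤ S f n + S g n + (1 / (n + 1) + 1 / (n + 1)) := by
      rw [← hm.simpleIntegral_const (1 / ((n : ℝ) + 1) + 1 / (n + 1)), ← hm.simpleIntegral_add,
        ← hm.simpleIntegral_add]
      refine hm.simpleIntegral_mono fun x => ?_
      have h₁ := floorApprox_le n (hs' x)
      have h₂ := le_floorApprox_add n (hf' x)
      have h₃ := le_floorApprox_add n (hg' x)
      simp only [Pi.add_apply, SimpleFunc.coe_add, SimpleFunc.coe_const,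
        Function.const_apply] at h₁ ⊢
      linarith
    have lower n : S f n + S g n ≤ S (f + g) n + 1 / (n + 1) := by
      rw [← hm.simpleIntegral_const (1 / ((n : ℝ) + 1)), ← hm.simpleIntegral_add,
        ← hm.simpleIntegral_add]
      refine hm.simpleIntegral_mono fun x => ?_
      have h₁ := le_floorApprox_add n (hs' x)
      have h₂ := floorApprox_le n (hf' x)
      have h₃ := floorApprox_le n (hg' x)
      simp only [Pi.add_apply, SimpleFunc.coe_add, SimpleFunc.coe_const,
        Function.const_apply] at h₁ ⊢
      linarith
    apply le_antisymm
    · simpa using le_of_tendsto_of_tendsto' (hIlim (f + g))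
        (((hIlim f).add (hIlim g)).add (hsmall.add hsmall)) upper
    · simpa using le_of_tendsto_of_tendsto' ((hIlim f).add (hIlim g))
        ((hIlim (f + g)).add hsmall) lower
  · have h : S (f ∘ e) = S f := funext fun n => simpleIntegral_eq_of_comp e he rfl
    exact tendsto_nhds_unique (h ▸ hIlim (f ∘ e)) (hIlim f)

lemma le_one (hm : IsMean m) (A : Set Z) : m A ≤ 1 := by
  have h := hm.2.2 A Aᶜ disjoint_compl_right
  rw [Set.union_compl_self, hm.1] at h
  linarith [hm.2.1 Aᶜ]

lemma smul_left {G : Type*} [Group G] [MulAction G Z] (hm : IsMean m) (g : G) :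
    IsMean fun A => m (g • A) :=
  ⟨by simpa using hm.1, fun _ => hm.2.1 _, fun A B hAB => by
    simpa only [Set.smul_set_union] using hm.2.2 (g • A) (g • B) ((Set.disjoint_image_iff (MulAction.injective g)).2 hAB)⟩

end IsMean

/-- Means invariant under the point stabilizers can be chosen equivariantly. -/
theorem exists_equivariant_isMean {G X Y : Type*} [Group G] [MulAction G X] [MulAction G Y]
    (hY : ∀ x : X, ∃ m : Set Y → ℝ, IsMean m ∧
      ∀ g ∈ MulAction.stabilizer G x, ∀ A : Set Y, m (g • A) = m A) :
    ∃ M : X → Set Y → ℝ, (∀ x, IsMean (M x)) ∧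
      ∀ (g : G) (x : X) (A : Set Y), M (g • x) (g • A) = M x A := by
  choose μ hμ hinv using hY
  let r (x : X) : X := (Quotient.mk (MulAction.orbitRel G X) x).out
  have hr (x : X) : ∃ h : G, h • r x = x :=
    (MulAction.orbitRel G X).symm (Quotient.mk_out (s := MulAction.orbitRel G X) x)
  choose h hh using hr
  have hrg (g : G) (x : X) : r (g • x) = r x :=
    congrArg Quotient.out (Quotient.sound (s := MulAction.orbitRel G X) ⟨g, rfl⟩)
  refine ⟨fun x A => μ (r x) ((h x)⁻¹ • A), fun x => (hμ _).smul_left _, fun g x A => ?_⟩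
  have hstab : (h (g • x))⁻¹ * g * h x ∈ MulAction.stabilizer G (r x) := by
    rw [MulAction.mem_stabilizer_iff, mul_smul, mul_smul, hh, inv_smul_eq_iff]
    conv_rhs => rw [← hrg g x, hh]
  have := hinv _ _ hstab ((h x)⁻¹ • A)
  rw [smul_smul, mul_inv_cancel_right, mul_smul] at this
  simpa only [hrg] using this

/-- If the action `G ↷ X` admits an invariant mean and for every `x ∈ X` the action of the
stabilizer `G_x` on `Y` admits an invariant mean, then `G ↷ Y` admits an invariant mean. -/
theorem stmt11 {G X Y : Type*} [Group G] [MulAction G X] [MulAction G Y]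
    (hX : ∃ m : Set X → ℝ, IsMean m ∧ ∀ (g : G) (A : Set X), m (g • A) = m A)
    (hY : ∀ x : X, ∃ m : Set Y → ℝ, IsMean m ∧
      ∀ g ∈ MulAction.stabilizer G x, ∀ A : Set Y, m (g • A) = m A) :
    ∃ m : Set Y → ℝ, IsMean m ∧ ∀ (g : G) (A : Set Y), m (g • A) = m A := by
  obtain ⟨μ, hμ, hinv⟩ := hX
  obtain ⟨M, hM, hMg⟩ := exists_equivariant_isMean hY
  obtain ⟨I, I_one, I_nonneg, I_add, I_comp⟩ := hμ.exists_integral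
  refine ⟨fun A => I fun x => M x A, ⟨?_, fun _ => I_nonneg _, fun A B hAB => ?_⟩, fun g A => ?_⟩
  · rw [← I_one]
    exact congrArg I (funext fun x => (hM x).1)
  · rw [← I_add _ _ (fun x => (hM x).2.1 A) (fun x => (hM x).2.1 B)
      (fun x => (hM x).2.2 A B hAB ▸ (hM x).le_one _)]
    exact congrArg I (funext fun x => (hM x).2.2 A B hAB)
  · refine (I_comp (MulAction.toPerm g) (fun B => ?_) _).symm.trans ?_
    · rw [← hinv g⁻¹ B, ← Set.preimage_smul g B]
      rfl
    · exact congrArg I (funext fun x => hMg g x A)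
end

section
/- Let H be a countable discrete group, let H* = H ∖ {1_H}, and consider the generalized Bernoulli action of H on the product probability space ([0,1]^{H*}, λ^{H*}), where λ is Lebesgue measure on [0,1] and (g·y)(h) = y(g^{-1}hg) for g ∈ H, y ∈ [0,1]^{H*}, h ∈ H*. Suppose there exist sequences (c_n)_{n∈ℕ} and (d_n)_{n∈ℕ} in H which are asymptotically central in H and satisfy c_n d_n ≠ d_n c_n for all n. Then the action H ↷ ([0,1]^{H*}, λ^{H*}) admits a stability sequence. -/
open MeasureTheory Filter

/-- A stability sequence for a measure-preserving action `act` of a countable group `G` on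
`(Y, ν)` (Jones–Schmidt): a sequence `(Tₙ, Aₙ)` with `Tₙ : Y → G` measurable such that
`Tₙ⁰ : y ↦ act (Tₙ y) y` is a `ν`-preserving automorphism, satisfying asymptotic
equivariance, asymptotic triviality on sets, asymptotic invariance of `Aₙ`, and
`ν(Tₙ⁰(Aₙ) Δ Aₙ) ≥ 1/2`. -/
def HasStabilitySeq {G Y : Type*} [Group G] [MeasurableSpace Y]
    (ν : Measure Y) (act : G → Y → Y) : Prop :=
  ∃ (T : ℕ → Y → G) (A : ℕ → Set Y),
    (∀ (n : ℕ) (g : G), MeasurableSet {y | T n y = g}) ∧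
    (∀ n, MeasurableSet (A n)) ∧
    (∀ n, MeasurePreserving (fun y => act (T n y) y) ν ν) ∧
    (∀ n, ∃ Sinv : Y → Y, Measurable Sinv ∧
      (∀ᵐ y ∂ν, Sinv (act (T n y) y) = y) ∧
      (∀ᵐ y ∂ν, act (T n (Sinv y)) (Sinv y) = y)) ∧
    (∀ g : G, Tendsto (fun n => ν {y | T n (act g y) = g * T n y * g⁻¹}) atTop
      (nhds 1)) ∧
    (∀ B : Set Y, MeasurableSet B →
      Tendsto (fun n => ν (symmDiff ((fun y => act (T n y) y) '' B) B)) atTop (nhds 0)) ∧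
    (∀ g : G, Tendsto (fun n => ν (symmDiff (act g '' A n) (A n))) atTop (nhds 0)) ∧
    (∀ n : ℕ, 1 / 2 ≤ ν (symmDiff ((fun y => act (T n y) y) '' A n) (A n)))

/-- The generalized Bernoulli action of `H` on `[0,1]^{H∖{1}}` induced by conjugation:
`(g • y) h = y (g⁻¹ h g)`. -/
def bernAct {H : Type*} [Group H] (g : H) (y : {h : H // h ≠ 1} → ℝ) :
    {h : H // h ≠ 1} → ℝ :=
  fun h => y ⟨g⁻¹ * (h : H) * g, fun e => h.2 (by
    have h1 : (h : H) = g * (g⁻¹ * (h : H) * g) * g⁻¹ := by group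
    rw [e] at h1; simpa using h1)⟩

open MeasurableSpace in
/-- To prove that measure-preserving maps asymptotically fix every measurable set,
it suffices to check a generating π-system. -/
theorem tendsto_measure_symmDiff_preimage {Y : Type*} {m : MeasurableSpace Y}
    {ν : Measure Y} [IsFiniteMeasure ν] {θ : ℕ → Y → Y} (hθ : ∀ n, MeasurePreserving (θ n) ν ν)
    {C : Set (Set Y)} (hC : m = generateFrom C) (hpi : IsPiSystem C)
    (hlim : ∀ B ∈ C, Tendsto (fun n => ν (symmDiff (θ n ⁻¹' B) B)) atTop (nhds 0))
    (B : Set Y) (hB : MeasurableSet B) :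
    Tendsto (fun n => ν (symmDiff (θ n ⁻¹' B) B)) atTop (nhds 0) := by
  induction B, hB using induction_on_inter hC hpi with
  | empty => simp
  | basic t ht => exact hlim t ht
  | compl t _ ih => simpa only [Set.preimage_compl, compl_symmDiff_compl] using ih
  | iUnion f hdisj hf ih =>
    have hsum : Tendsto (fun n => ∑' i, ν (symmDiff (θ n ⁻¹' f i) (f i))) atTop (nhds 0) := by
      simp_rw [← lintegral_count]
      have key := tendsto_lintegral_of_dominated_convergence (μ := Measure.count)
        (F := fun n i => ν (symmDiff (θ n ⁻¹' f i) (f i))) (f := fun _ => 0)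
        (fun i => ν (f i) + ν (f i)) (fun n => measurable_of_countable _)
        (fun n => ae_of_all _ fun i => ?_) ?_ (ae_of_all _ ih)
      · simpa using key
      · refine (measure_mono (t := θ n ⁻¹' f i ∪ f i) symmDiff_le_sup).trans
          ((measure_union_le _ _).trans_eq ?_)
        rw [(hθ n).measure_preimage (hf i).nullMeasurableSet]
      · rw [lintegral_count, ENNReal.tsum_add, ← measure_iUnion hdisj hf]
        exact ENNReal.add_ne_top.2 ⟨measure_ne_top _ _, measure_ne_top _ _⟩
    refine tendsto_of_tendsto_of_tendsto_of_le_of_le tendsto_const_nhds hsum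
      (fun _ => zero_le) fun n => ?_
    refine (measure_mono ?_).trans (measure_iUnion_le _)
    intro y
    simp only [Set.mem_symmDiff, Set.mem_preimage, Set.mem_iUnion]
    rintro (⟨⟨i, hi⟩, h⟩ | ⟨⟨i, hi⟩, h⟩)
    · exact ⟨i, Or.inl ⟨hi, fun h' => h ⟨i, h'⟩⟩⟩
    · exact ⟨i, Or.inr ⟨hi, fun h' => h ⟨i, h'⟩⟩⟩

section BernoulliAction

variable {H : Type*} [Group H]

theorem bernAct_apply_of_eq {g : H} {h k : {h : H // h ≠ 1}} (e : g⁻¹ * (h : H) * g = k)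
    (y : {h : H // h ≠ 1} → ℝ) : bernAct g y h = y k :=
  congrArg y (Subtype.ext e)

theorem bernAct_apply_of_commute {g : H} {h : {h : H // h ≠ 1}} (e : (h : H) * g = g * h)
    (y : {h : H // h ≠ 1} → ℝ) : bernAct g y h = y h :=
  bernAct_apply_of_eq (by rw [mul_assoc, e]; group) y

theorem bernAct_inv_left (g : H) : Function.LeftInverse (bernAct g⁻¹) (bernAct g) := fun y =>
  funext fun h => congrArg y (Subtype.ext (by simp only; group))

theorem bernAct_inv_right (g : H) : Function.RightInverse (bernAct g⁻¹) (bernAct g) := fun y => by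
  simpa using bernAct_inv_left g⁻¹ y

theorem image_bernAct (g : H) (A : Set ({h : H // h ≠ 1} → ℝ)) :
    bernAct g '' A = bernAct g⁻¹ ⁻¹' A :=
  congrFun (Set.image_eq_preimage_of_inverse (bernAct_inv_left g) (bernAct_inv_right g)) A

theorem measurable_bernAct (g : H) : Measurable (bernAct g) :=
  measurable_pi_lambda _ fun _ => measurable_pi_apply _

/-- Conjugation by `g` as a permutation of `H ∖ {1}`. -/
def conjNeOne (g : H) : Equiv.Perm {h : H // h ≠ 1} :=
  (MulAut.conj g).toEquiv.subtypeEquiv fun h => by simp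

theorem bernAct_conjNeOne (g : H) (y : {h : H // h ≠ 1} → ℝ) (h : {h : H // h ≠ 1}) :
    bernAct g y (conjNeOne g h) = y h :=
  bernAct_apply_of_eq (by simp [conjNeOne, mul_assoc]) y

instance isProbabilityMeasure_volume_restrict_Icc_zero_one :
    IsProbabilityMeasure ((volume : Measure ℝ).restrict (Set.Icc 0 1)) :=
  ⟨by simp⟩

theorem measurePreserving_bernAct_infinitePi (g : H) :
    MeasurePreserving (bernAct g)
      (Measure.infinitePi fun _ : {h : H // h ≠ 1} =>
        (volume : Measure ℝ).restrict (Set.Icc 0 1))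
      (Measure.infinitePi fun _ => volume.restrict (Set.Icc 0 1)) := by
  refine ⟨measurable_bernAct g, ?_⟩
  have e : (bernAct g : ({h : H // h ≠ 1} → ℝ) → _) =
      MeasurableEquiv.piCongrLeft (fun _ => ℝ) (conjNeOne g) := by
    funext y h
    obtain ⟨k, rfl⟩ := (conjNeOne g).surjective h
    rw [bernAct_conjNeOne]
    exact (Equiv.piCongrLeft_apply_apply (fun _ => ℝ) (conjNeOne g) y k).symm
  rw [e]
  exact Measure.infinitePi_map_piCongrLeft (fun _ => volume.restrict (Set.Icc 0 1)) (conjNeOne g)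

/-- Group elements that eventually commute with each fixed element act asymptotically trivially
on measurable sets. -/
theorem tendsto_measure_symmDiff_image_bernAct {μ : Measure ({h : H // h ≠ 1} → ℝ)}
    [IsFiniteMeasure μ] (hμ : ∀ g, MeasurePreserving (bernAct g) μ μ) {c : ℕ → H}
    (hc : ∀ h : H, ∀ᶠ n in atTop, h * c n = c n * h)
    (B : Set ({h : H // h ≠ 1} → ℝ)) (hB : MeasurableSet B) :
    Tendsto (fun n => μ (symmDiff (bernAct (c n) '' B) B)) atTop (nhds 0) := by
  simp_rw [image_bernAct]
  refine tendsto_measure_symmDiff_preimage (fun n => hμ (c n)⁻¹)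
    generateFrom_measurableCylinders.symm isPiSystem_measurableCylinders (fun C hC => ?_) B hB
  obtain ⟨s, S, -, rfl⟩ := (mem_measurableCylinders C).1 hC
  refine tendsto_const_nhds.congr' ?_
  filter_upwards [(Filter.eventually_all_finset s).2 fun h _ => hc h] with n hn
  have : bernAct (c n)⁻¹ ⁻¹' cylinder s S = cylinder s S := by
    ext y
    have : s.restrict (bernAct (c n)⁻¹ y) = s.restrict y := funext fun h =>
      bernAct_apply_of_commute (Commute.inv_right (hn h h.2)) y
    rw [Set.mem_preimage, mem_cylinder, mem_cylinder, this]
  simp [this]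

end BernoulliAction

theorem half_le_infinitePi_symmDiff {ι : Type*} {i j : ι} (hij : i ≠ j) :
    1 / 2 ≤ Measure.infinitePi (fun _ : ι => (volume : Measure ℝ).restrict (Set.Icc 0 1))
      (symmDiff {y | y i ≤ 1 / 2} {y | y j ≤ 1 / 2}) := by
  classical
  have hle : (volume : Measure ℝ).restrict (Set.Icc 0 1) (Set.Iic (1 / 2)) = 2⁻¹ := by
    have : Set.Iic (1 / 2 : ℝ) ∩ Set.Icc 0 1 = Set.Icc 0 (1 / 2) := by
      ext x
      simp only [Set.mem_inter_iff, Set.mem_Iic, Set.mem_Icc]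
      constructor <;> intro h <;> refine ⟨?_, ?_⟩ <;> grind
    rw [Measure.restrict_apply measurableSet_Iic, this, Real.volume_Icc, sub_zero, one_div,
      ENNReal.ofReal_inv_of_pos two_pos, ENNReal.ofReal_ofNat]
  have hgt : (volume : Measure ℝ).restrict (Set.Icc 0 1) (Set.Ioi (1 / 2)) = 2⁻¹ := by
    rw [← Set.compl_Iic, prob_compl_eq_one_sub measurableSet_Iic, hle, ENNReal.one_sub_inv_two]
  have quarter : ∀ {i j : ι}, i ≠ j →
      Measure.infinitePi (fun _ : ι => (volume : Measure ℝ).restrict (Set.Icc 0 1))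
        {y | y i ≤ 1 / 2 ∧ ¬ y j ≤ 1 / 2} = 2⁻¹ * 2⁻¹ := by
    intro i j hij
    have key := Measure.infinitePi_pi
      (fun _ : ι => (volume : Measure ℝ).restrict (Set.Icc 0 1)) (s := {i, j})
      (t := fun k => if k = i then Set.Iic (1 / 2) else Set.Ioi (1 / 2))
      fun k _ => by split_ifs <;> measurability
    rw [Finset.prod_pair hij, if_pos rfl, if_neg hij.symm, hle, hgt] at key
    rw [← key]
    congr 1
    ext y
    simp [hij.symm]
  have hmeas : ∀ i : ι, MeasurableSet {y : ι → ℝ | y i ≤ 1 / 2} := fun i =>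
    measurableSet_le (measurable_pi_apply i) measurable_const
  rw [measure_symmDiff_eq (hmeas i).nullMeasurableSet (hmeas j).nullMeasurableSet]
  refine le_of_eq ?_
  rw [show ({y : ι → ℝ | y i ≤ 1 / 2} \ {y | y j ≤ 1 / 2}) =
      {y | y i ≤ 1 / 2 ∧ ¬ y j ≤ 1 / 2} from rfl,
    show ({y : ι → ℝ | y j ≤ 1 / 2} \ {y | y i ≤ 1 / 2}) =
      {y | y j ≤ 1 / 2 ∧ ¬ y i ≤ 1 / 2} from rfl,
    quarter hij, quarter hij.symm, ← mul_add, ENNReal.inv_two_add_inv_two, mul_one, one_div]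

/-- If a countable group `H` has two noncommuting asymptotically central sequences, then
the generalized Bernoulli action of `H` on `([0,1]^{H*}, λ^{H*})` (here `μ` is the product
of copies of Lebesgue measure on `[0,1]`, characterized by its values on cylinder sets)
admits a stability sequence. -/
theorem stmt14 {H : Type*} [Group H] [Countable H]
    (μ : Measure ({h : H // h ≠ 1} → ℝ)) [IsProbabilityMeasure μ]
    (hcyl : ∀ (s : Finset {h : H // h ≠ 1}) (B : {h : H // h ≠ 1} → Set ℝ),
      (∀ i, MeasurableSet (B i)) →
      μ {y | ∀ i ∈ s, y i ∈ B i} =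
        ∏ i ∈ s, (volume.restrict (Set.Icc (0 : ℝ) 1)) (B i))
    (c d : ℕ → H)
    (hc : ∀ h : H, {n : ℕ | ¬ h * c n = c n * h}.Finite)
    (hd : ∀ h : H, {n : ℕ | ¬ h * d n = d n * h}.Finite)
    (hcd : ∀ n, c n * d n ≠ d n * c n) :
    HasStabilitySeq μ bernAct := by
  obtain rfl : μ = Measure.infinitePi fun _ => volume.restrict (Set.Icc 0 1) :=
    Measure.eq_infinitePi _ hcyl
  have hc' : ∀ h : H, ∀ᶠ n in atTop, h * c n = c n * h := fun h => by
    rw [← Nat.cofinite_eq_atTop]; exact hc h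
  have hd' : ∀ h : H, ∀ᶠ n in atTop, h * d n = d n * h := fun h => by
    rw [← Nat.cofinite_eq_atTop]; exact hd h
  have hd1 : ∀ n, d n ≠ 1 := fun n h => hcd n (by simp [h])
  refine ⟨fun n _ => c n, fun n => {y | y ⟨d n, hd1 n⟩ ≤ 1 / 2}, fun n g => .const _,
    fun n => measurableSet_le (measurable_pi_apply _) measurable_const,
    fun n => measurePreserving_bernAct_infinitePi (c n),
    fun n => ⟨bernAct (c n)⁻¹, measurable_bernAct _, ae_of_all _ (bernAct_inv_left (c n)),
      ae_of_all _ (bernAct_inv_right (c n))⟩, fun g => ?_,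
    tendsto_measure_symmDiff_image_bernAct measurePreserving_bernAct_infinitePi hc',
    fun g => ?_, fun n => ?_⟩
  · refine tendsto_const_nhds.congr' ?_
    filter_upwards [hc' g] with n hn
    simp [hn]
  · refine tendsto_const_nhds.congr' ?_
    filter_upwards [hd' g⁻¹] with n hn
    have hfix : ∀ y, bernAct g⁻¹ y ⟨d n, hd1 n⟩ = y ⟨d n, hd1 n⟩ :=
      bernAct_apply_of_commute hn.symm
    simp [image_bernAct, hfix]
  · rw [image_bernAct]
    refine half_le_infinitePi_symmDiff fun h => hcd n ?_
    have h' := congrArg Subtype.val h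
    simp only [inv_inv] at h'
    exact mul_inv_eq_iff_eq_mul.1 h'
end
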